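/- Let μ be a Borel probability measure on Ω⁺ invariant under the shift S, and for n ∈ ℕ let E_n = {μ(C_u) : u ∈ L(Ω), |u| = n} be the set of distinct values taken by the measures of cylinders of length n. Then the cardinality of E_1 is d, and for every n ≥ 2, the cardinality of E_n is 2d−2 if L(Ω) contains a bispecial word of length n−1, and 2d−1 otherwise. -/

import Mathlib

/-- The substitution σ on the alphabet A = {1, …, d}:
σ(1) = 12, σ(k) = k+1 for 2 ≤ k ≤ d−1, σ(d) = 1. Letters are literal natural numbers. -/
def sig (d : ℕ) (a : ℕ) : List ℕ :=
  if a = 1 then [1, 2] else if a = d then [1] else [a + 1]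

/-- Extension of a substitution to finite words by concatenation. -/
def applySub (f : ℕ → List ℕ) : List ℕ → List ℕ
  | [] => []
  | a :: w => f a ++ applySub f w

/-- σⁿ applied to a word. -/
def sigIter (d n : ℕ) (w : List ℕ) : List ℕ := (applySub (sig d))^[n] w

/-- The language L(Ω): the set of finite factors of the fixed point ω, i.e. of the
words σⁿ(1). -/
def Lang (d : ℕ) (u : List ℕ) : Prop := ∃ n : ℕ, u <:+: sigIter d n [1]

/-- `w` is a (finite) prefix of the infinite word `V`. -/
def PrefixOfInf (w : List ℕ) (V : ℕ → ℕ) : Prop :=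
  ∀ (i : ℕ) (h : i < w.length), w.get ⟨i, h⟩ = V i

/-- `ω` is the fixed point of σ: the unique infinite word admitting every σⁿ(1) as a
prefix. -/
def IsSigmaFixedPoint (d : ℕ) (ω : ℕ → ℕ) : Prop :=
  ∀ n : ℕ, PrefixOfInf (sigIter d n [1]) ω

/-- `u` is left-special: there are distinct letters a, b ∈ A with au, bu ∈ L(Ω). -/
def LeftSpecial (d : ℕ) (u : List ℕ) : Prop :=
  ∃ a b : ℕ, a ≠ b ∧ 1 ≤ a ∧ a ≤ d ∧ 1 ≤ b ∧ b ≤ d ∧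
    Lang d (a :: u) ∧ Lang d (b :: u)

/-- `u` is right-special: there are distinct letters a, b ∈ A with ua, ub ∈ L(Ω). -/
def RightSpecial (d : ℕ) (u : List ℕ) : Prop :=
  ∃ a b : ℕ, a ≠ b ∧ 1 ≤ a ∧ a ≤ d ∧ 1 ≤ b ∧ b ≤ d ∧
    Lang d (u ++ [a]) ∧ Lang d (u ++ [b])

/-- `u` is bispecial: both left- and right-special. -/
def Bispecial (d : ℕ) (u : List ℕ) : Prop := LeftSpecial d u ∧ RightSpecial d u

/-- The shift S on infinite words. -/
def shiftMap (V : ℕ → ℕ) : ℕ → ℕ := fun i => V (i + 1)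

/-- Ω⁺ : the closure (for the product topology, letters discrete) of the shift
orbit of ω. -/
def OmegaPlus (ω : ℕ → ℕ) : Set (ℕ → ℕ) :=
  closure {V : ℕ → ℕ | ∃ n : ℕ, V = shiftMap^[n] ω}

/-- The cylinder C_u = {V ∈ Ω⁺ : u is a prefix of V}. -/
def Cyl (ω : ℕ → ℕ) (u : List ℕ) : Set (ℕ → ℕ) :=
  {V | V ∈ OmegaPlus ω ∧ PrefixOfInf u V}

/-- Prepending a letter to an infinite word. -/
def consInf (a : ℕ) (V : ℕ → ℕ) : ℕ → ℕ :=
  fun i => match i with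
  | 0 => a
  | j + 1 => V j

/-- Extension of σ to infinite words: σ(V) = σ(V₀)σ(V₁)σ(V₂)⋯ (each σ(a) is a
nonempty word, so the n-th letter of σ(V) is the n-th letter of σ(V₀…Vₙ)). -/
def sigInf (d : ℕ) (V : ℕ → ℕ) : ℕ → ℕ :=
  fun n => (applySub (sig d) ((List.range (n + 1)).map V)).getD n 0

/-- Concatenation of a finite list of words. -/
def concatAll : List (List ℕ) → List ℕ
  | [] => []
  | w :: ws => w ++ concatAll ws

/-- The set E_n of values of μ on cylinders of words of length n in L(Ω). -/
noncomputable def cylValues (ω : ℕ → ℕ) (μ : MeasureTheory.Measure (ℕ → ℕ))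
    (d n : ℕ) : Set ℝ :=
  {x | ∃ u : List ℕ, Lang d u ∧ u.length = n ∧ (μ (Cyl ω u)).toReal = x}

section Words

lemma applySub_append (f : ℕ → List ℕ) (u v : List ℕ) :
    applySub f (u ++ v) = applySub f u ++ applySub f v := by
  induction u with
  | nil => rfl
  | cons a u ih => simp [applySub, ih]

lemma applySub_singleton (f : ℕ → List ℕ) (a : ℕ) : applySub f [a] = f a := by
  simp [applySub]

lemma sig_one (d : ℕ) : sig d 1 = [1, 2] := by simp [sig]

lemma sig_last {d : ℕ} (hd : 3 ≤ d) : sig d d = [1] := by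
  simp [sig, show d ≠ 1 by omega]

lemma sig_mid {d a : ℕ} (h1 : a ≠ 1) (h2 : a ≠ d) : sig d a = [a + 1] := by
  simp [sig, h1, h2]

lemma sig_cases (d a : ℕ) : (a = 1 ∧ sig d a = [1, 2]) ∨ (a = d ∧ sig d a = [1]) ∨
    (a ≠ 1 ∧ a ≠ d ∧ sig d a = [a + 1]) := by
  unfold sig; split_ifs <;> simp_all

/-- The last letter of the image of a letter under the substitution. -/
def sigTail (d a : ℕ) : ℕ := if a = d then 1 else a + 1

lemma sig_eq_append_sigTail {d : ℕ} (hd : 3 ≤ d) (a : ℕ) :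
    ∃ w, sig d a = w ++ [sigTail d a] := by
  rcases eq_or_ne a 1 with rfl | h1
  · exact ⟨[1], by simp [sig, sigTail, show (1 : ℕ) ≠ d by omega]⟩
  · rcases eq_or_ne a d with rfl | h2
    · exact ⟨[], by simp [sig_last hd, sigTail]⟩
    · exact ⟨[], by simp [sig_mid h1 h2, sigTail, h2]⟩

lemma exists_sigTail_eq {d a : ℕ} (h1 : 1 ≤ a) (h2 : a ≤ d) :
    ∃ b, 1 ≤ b ∧ b ≤ d ∧ sigTail d b = a := by
  rcases eq_or_ne a 1 with rfl | h
  · exact ⟨d, by omega, le_rfl, by simp [sigTail]⟩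
  · exact ⟨a - 1, by omega, by omega, by
      rw [sigTail, if_neg (by omega)]; omega⟩

lemma sigTail_mem {d : ℕ} (hd : 3 ≤ d) {a : ℕ} (h2 : a ≤ d) :
    1 ≤ sigTail d a ∧ sigTail d a ≤ d := by
  unfold sigTail; split_ifs <;> omega

lemma length_sig_pos (d a : ℕ) : 1 ≤ (sig d a).length := by
  unfold sig; split_ifs <;> simp

lemma length_le_length_applySub (d : ℕ) (w : List ℕ) :
    w.length ≤ (applySub (sig d) w).length := by
  induction w with
  | nil => simp
  | cons a w ih =>
    have := length_sig_pos d a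
    simp only [applySub, List.length_append, List.length_cons]; omega

lemma length_lt_length_applySub (d : ℕ) (w : List ℕ) :
    (1 :: w).length < (applySub (sig d) (1 :: w)).length := by
  have := length_le_length_applySub d w
  simp only [applySub, sig_one, List.length_append, List.length_cons, List.length_nil]; omega

/-- Words over `{1, …, d}` in which every letter other than `1` follows its predecessor. -/
def Admissible (d : ℕ) (w : List ℕ) : Prop :=
  (∀ a ∈ w, 1 ≤ a ∧ a ≤ d) ∧ w.IsChain fun a b => b = 1 ∨ b = a + 1

lemma Admissible.of_isInfix {d : ℕ} {u w : List ℕ} (hw : Admissible d w) (h : u <:+: w) :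
    Admissible d u :=
  ⟨fun a ha => hw.1 a (h.subset ha), hw.2.infix h⟩

lemma Admissible.pair {d : ℕ} {p s : List ℕ} {a b : ℕ}
    (h : Admissible d (p ++ a :: b :: s)) : b = 1 ∨ b = a + 1 := by
  have := (h.of_isInfix (u := [a, b]) ⟨p, s, by simp⟩).2
  simpa using this

lemma applySub_head_ne_two {d : ℕ} {w s : List ℕ} (hw : ∀ a ∈ w, 1 ≤ a)
    (hs : s.head? ≠ some 2) : (applySub (sig d) w ++ s).head? ≠ some 2 := by
  cases w with
  | nil => simpa [applySub] using hs
  | cons a w =>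
    have := hw a (by simp)
    simp only [applySub, sig]
    split_ifs
    · simp
    · simp
    · simp; omega

lemma Admissible.applySub {d : ℕ} (hd : 3 ≤ d) {w : List ℕ} (hw : Admissible d w) :
    Admissible d (applySub (sig d) w) := by
  constructor
  · obtain ⟨hw, -⟩ := hw
    induction w with
    | nil => simp [_root_.applySub]
    | cons a w ih =>
      intro b hb
      rw [_root_.applySub, List.mem_append] at hb
      rcases hb with hb | hb
      · have := hw a (by simp)
        unfold sig at hb
        split_ifs at hb <;> simp at hb <;> omega
      · exact ih (fun x hx => hw x (by simp [hx])) b hb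
  · induction w with
    | nil => simp [_root_.applySub]
    | cons a w ih =>
      have ih := ih (hw.of_isInfix ⟨[a], [], by simp⟩)
      cases w with
      | nil =>
        simp only [_root_.applySub, sig]
        split_ifs <;> simp
      | cons b w =>
        have hab : b = 1 ∨ b = a + 1 := hw.pair (p := [])
        have ha := hw.1 a (by simp)
        have hb := hw.1 b (by simp)
        rw [_root_.applySub]
        simp only [_root_.applySub] at ih ⊢
        rcases sig_cases d b with ⟨hb', h⟩ | ⟨hb', h⟩ | ⟨hb', hb'', h⟩ <;>
        rcases sig_cases d a with ⟨ha', h'⟩ | ⟨ha', h'⟩ | ⟨ha', ha'', h'⟩ <;>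
        rw [h] at ih ⊢ <;> rw [h'] <;>
        simp only [List.cons_append, List.nil_append, List.isChain_cons_cons] at ih ⊢ <;>
        first
        | exact ⟨by simp, by first | omega | simp, ih⟩
        | exact ⟨by first | omega | simp, ih⟩

lemma sigIter_succ (d n : ℕ) (w : List ℕ) :
    sigIter d (n + 1) w = applySub (sig d) (sigIter d n w) :=
  Function.iterate_succ_apply' _ _ _

lemma sigIter_prefix_succ (d n : ℕ) : sigIter d n [1] <+: sigIter d (n + 1) [1] := by
  induction n with
  | zero => exact ⟨[2], by simp [sigIter, applySub, sig]⟩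
  | succ n ih =>
    obtain ⟨s, hs⟩ := ih
    rw [sigIter_succ, sigIter_succ d (n + 1), ← hs, applySub_append]
    exact List.prefix_append _ _

lemma admissible_sigIter {d : ℕ} (hd : 3 ≤ d) (n : ℕ) : Admissible d (sigIter d n [1]) := by
  induction n with
  | zero => exact ⟨by simp [sigIter]; omega, by simp [sigIter]⟩
  | succ n ih => rw [sigIter_succ]; exact ih.applySub hd

lemma Lang.admissible {d : ℕ} (hd : 3 ≤ d) {u : List ℕ} (hu : Lang d u) : Admissible d u := by
  obtain ⟨n, hn⟩ := hu
  exact (admissible_sigIter hd n).of_isInfix hn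

lemma Lang.of_isInfix {d : ℕ} {u v : List ℕ} (hv : Lang d v) (h : u <:+: v) : Lang d u := by
  obtain ⟨n, hn⟩ := hv
  exact ⟨n, h.trans hn⟩

lemma exists_eq_sig_append {d : ℕ} (hd : 3 ≤ d) {c : ℕ} {W p t : List ℕ}
    (ht : t.head? ≠ some 2) (h : sig d c ++ W = p ++ t) (hp : p ≠ []) :
    ∃ q, p = sig d c ++ q ∧ W = q ++ t := by
  rcases List.append_eq_append_iff.1 h with ⟨q, h1, h2⟩ | ⟨q, h1, h2⟩
  · exact ⟨q, h1, h2⟩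
  · obtain ⟨x, p', rfl⟩ := List.exists_cons_of_ne_nil hp
    unfold sig at h1
    split_ifs at h1
    · simp only [List.cons_append, List.cons.injEq] at h1
      obtain ⟨rfl, h1⟩ := h1
      cases p' with
      | nil => simp at h1; subst h1; simp [h2] at ht
      | cons y p' =>
        simp at h1
        obtain ⟨rfl, rfl, rfl⟩ := h1
        exact ⟨[], by simp [sig_one, *], by simpa using h2.symm⟩
    · simp at h1
      obtain ⟨rfl, rfl, rfl⟩ := h1
      exact ⟨[], by simp [sig_last hd, *], by simpa using h2.symm⟩
    · simp at h1
      obtain ⟨rfl, rfl, rfl⟩ := h1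
      exact ⟨[], by simp [sig_mid, *], by simpa using h2.symm⟩

lemma prefix_of_applySub_append {d : ℕ} {u W t : List ℕ}
    (hu : ∀ a ∈ u, 1 ≤ a) (hW : ∀ a ∈ W, 1 ≤ a) (ht : t.head? ≠ some 2) (htne : t ≠ [])
    (h : applySub (sig d) W = applySub (sig d) u ++ t) : u <+: W := by
  induction u generalizing W with
  | nil => simp
  | cons e u ih =>
    cases W with
    | nil =>
      have := congrArg List.length h
      have h2 := List.length_pos_iff.2 htne
      simp [applySub] at this; omega
    | cons c W =>
      have hu' : ∀ a ∈ u, 1 ≤ a := fun a ha => hu a (by simp [ha])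
      have hW' : ∀ a ∈ W, 1 ≤ a := fun a ha => hW a (by simp [ha])
      have k1 := applySub_head_ne_two (d := d) hu' ht
      have k2 := applySub_head_ne_two (d := d) (s := []) hW' (by simp)
      have he := hu e (by simp)
      have hc := hW c (by simp)
      simp only [applySub, List.append_assoc] at h
      have hce : c = e := by
        by_contra hne
        rcases sig_cases d c with ⟨c', h'⟩ | ⟨c', h'⟩ | ⟨c', c'', h'⟩ <;>
        rcases sig_cases d e with ⟨e', h''⟩ | ⟨e', h''⟩ | ⟨e', e'', h''⟩ <;>
        rw [h', h''] at h <;>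
        simp only [List.cons_append, List.nil_append, List.cons.injEq, List.append_nil] at h k2 <;>
        first
        | omega
        | (rw [← h.2] at k1; simp at k1)
        | (rw [h.2] at k2; simp at k2)
      subst hce
      rw [List.append_cancel_left_eq] at h
      simpa using ih hu' hW' h

lemma infix_of_applySub_append {d : ℕ} (hd : 3 ≤ d) {u W p t : List ℕ}
    (hu : ∀ a ∈ u, 1 ≤ a) (hW : ∀ a ∈ W, 1 ≤ a) (ht : t.head? ≠ some 2) (htne : t ≠ [])
    (h : applySub (sig d) W = p ++ (applySub (sig d) u ++ t)) : u <:+: W := by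
  induction W generalizing p with
  | nil =>
    have := congrArg List.length h
    have h2 := List.length_pos_iff.2 htne
    simp [applySub] at this; omega
  | cons c W ih =>
    rcases eq_or_ne p [] with rfl | hp
    · exact (prefix_of_applySub_append hu hW ht htne h).isInfix
    · obtain ⟨q, -, hq⟩ := exists_eq_sig_append hd (applySub_head_ne_two hu ht)
        h hp
      exact (ih (fun a ha => hW a (by simp [ha])) hq).trans (List.suffix_cons c W).isInfix

end Words

section FixedPoint

/-- The factor of length `m` of `ω` starting at position `p`. -/
def factorAt (ω : ℕ → ℕ) (p m : ℕ) : List ℕ := (List.range m).map fun i => ω (p + i)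

@[simp] lemma length_factorAt (ω : ℕ → ℕ) (p m : ℕ) : (factorAt ω p m).length = m := by
  simp [factorAt]

@[simp] lemma factorAt_zero (ω : ℕ → ℕ) (p : ℕ) : factorAt ω p 0 = [] := rfl

lemma factorAt_add (ω : ℕ → ℕ) (p m k : ℕ) :
    factorAt ω p (m + k) = factorAt ω p m ++ factorAt ω (p + m) k := by
  simp [factorAt, List.range_add, Function.comp_def, add_assoc]

lemma factorAt_succ (ω : ℕ → ℕ) (p m : ℕ) :
    factorAt ω p (m + 1) = factorAt ω p m ++ [ω (p + m)] := by
  rw [factorAt_add]; simp [factorAt]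

lemma factorAt_succ' (ω : ℕ → ℕ) (p m : ℕ) :
    factorAt ω p (m + 1) = ω p :: factorAt ω (p + 1) m := by
  rw [add_comm m, factorAt_add]; simp [factorAt]

lemma factorAt_isPrefix (ω : ℕ → ℕ) (p : ℕ) {m n : ℕ} (h : m ≤ n) :
    factorAt ω p m <+: factorAt ω p n := by
  obtain ⟨k, rfl⟩ := Nat.exists_eq_add_of_le h
  exact ⟨_, (factorAt_add ω p m k).symm⟩

lemma prefixOfInf_iff {w : List ℕ} {V : ℕ → ℕ} :
    PrefixOfInf w V ↔ w = factorAt V 0 w.length := by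
  constructor
  · intro h
    refine List.ext_get (by simp) fun i h1 h2 => ?_
    rw [h i h1]; simp [factorAt]
  · intro h i hi
    have : w[i]? = (factorAt V 0 w.length)[i]? := by rw [← h]
    simpa [factorAt, hi] using this

lemma eq_factorAt_of_append {ω : ℕ → ℕ} {p u s : List ℕ} {q n : ℕ}
    (h : p ++ (u ++ s) = factorAt ω q n) : u = factorAt ω (q + p.length) u.length := by
  have hn := congrArg List.length h
  simp only [List.length_append, length_factorAt] at hn
  rw [← hn, factorAt_add, factorAt_add] at h
  exact (List.append_inj (List.append_inj h (by simp)).2 (by simp)).1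

lemma eq_factorAt_of_isPrefix {ω : ℕ → ℕ} {u : List ℕ} {q n : ℕ}
    (h : u <+: factorAt ω q n) : u = factorAt ω q u.length := by
  obtain ⟨s, hs⟩ := h
  simpa using eq_factorAt_of_append (p := []) hs

variable {d : ℕ} {ω : ℕ → ℕ}

lemma IsSigmaFixedPoint.sigIter_eq (hω : IsSigmaFixedPoint d ω) (n : ℕ) :
    sigIter d n [1] = factorAt ω 0 (sigIter d n [1]).length :=
  prefixOfInf_iff.1 (hω n)

lemma IsSigmaFixedPoint.zero_eq (hω : IsSigmaFixedPoint d ω) : ω 0 = 1 :=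
  (hω 0 0 (by simp [sigIter])).symm

lemma IsSigmaFixedPoint.one_eq (hω : IsSigmaFixedPoint d ω) : ω 1 = 2 := by
  have := hω 1 1 (by simp [sigIter, applySub, sig])
  simpa [sigIter, applySub, sig] using this.symm

lemma IsSigmaFixedPoint.lt_length_sigIter (hω : IsSigmaFixedPoint d ω) (n : ℕ) :
    n < (sigIter d n [1]).length := by
  induction n with
  | zero => simp [sigIter]
  | succ n ih =>
    rw [sigIter_succ]
    have h := hω.sigIter_eq n
    obtain ⟨m, hm⟩ : ∃ m, (sigIter d n [1]).length = m + 1 := ⟨_, (Nat.succ_pred (by omega)).symm⟩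
    rw [hm, factorAt_succ', hω.zero_eq] at h
    have := length_lt_length_applySub d (factorAt ω (0 + 1) m)
    rw [← h] at this
    omega

lemma IsSigmaFixedPoint.lang_factorAt (hω : IsSigmaFixedPoint d ω) (p m : ℕ) :
    Lang d (factorAt ω p m) := by
  refine ⟨p + m, ?_⟩
  obtain ⟨k, hk⟩ := Nat.exists_eq_add_of_lt (hω.lt_length_sigIter (p + m))
  rw [hω.sigIter_eq, hk, add_assoc, factorAt_add, factorAt_add]
  exact ⟨_, _, by rw [zero_add]⟩

lemma IsSigmaFixedPoint.eq_factorAt_of_lang (hω : IsSigmaFixedPoint d ω) {u : List ℕ}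
    (hu : Lang d u) : ∃ p, u = factorAt ω p u.length := by
  obtain ⟨n, p, s, h⟩ := hu
  rw [hω.sigIter_eq, List.append_assoc] at h
  exact ⟨_, eq_factorAt_of_append h⟩

lemma IsSigmaFixedPoint.applySub_eq (hω : IsSigmaFixedPoint d ω) (n : ℕ) :
    applySub (sig d) (factorAt ω 0 n) =
      factorAt ω 0 (applySub (sig d) (factorAt ω 0 n)).length := by
  have h1 : factorAt ω 0 n <+: sigIter d n [1] := by
    rw [hω.sigIter_eq]; exact factorAt_isPrefix _ _ (hω.lt_length_sigIter n).le
  obtain ⟨s, hs⟩ := h1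
  have h2 := hω.sigIter_eq (n + 1)
  rw [sigIter_succ, ← hs, applySub_append] at h2
  exact eq_factorAt_of_isPrefix ⟨_, h2⟩

lemma IsSigmaFixedPoint.one_le (hω : IsSigmaFixedPoint d ω) (hd : 3 ≤ d) (i : ℕ) :
    1 ≤ ω i ∧ ω i ≤ d :=
  ((hω.lang_factorAt i 1).admissible hd).1 _ (by simp [factorAt])

lemma IsSigmaFixedPoint.succ_eq (hω : IsSigmaFixedPoint d ω) (hd : 3 ≤ d) (i : ℕ) :
    ω (i + 1) = 1 ∨ ω (i + 1) = ω i + 1 := by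
  have := ((hω.lang_factorAt i 2).admissible hd).2
  simpa [factorAt, List.range_succ] using this

lemma IsSigmaFixedPoint.tail_ne (hω : IsSigmaFixedPoint d ω) {n : ℕ} (hn : 1 ≤ n) :
    factorAt ω 1 n ≠ factorAt ω 0 n := by
  obtain ⟨n, rfl⟩ := Nat.exists_eq_add_of_le' hn
  rw [factorAt_succ', factorAt_succ', hω.zero_eq, hω.one_eq]
  simp

end FixedPoint

section Weights

open Finset

/-- A shift-invariant weight on words, supported on the language. -/
structure InvWeight (d : ℕ) (f : List ℕ → ℝ) : Prop where
  nonneg : ∀ u, 0 ≤ f u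
  supp : ∀ u, ¬ Lang d u → f u = 0
  right : ∀ u, f u = ∑ a ∈ Icc 1 d, f (u ++ [a])
  left : ∀ u, f u = ∑ a ∈ Icc 1 d, f (a :: u)

/-- The weight induced on the desubstituted words. -/
noncomputable def desub (d : ℕ) (f : List ℕ → ℝ) (u : List ℕ) : ℝ :=
  open Classical in
  if ∀ a ∈ u, 1 ≤ a then f (applySub (sig d) u) - f (applySub (sig d) u ++ [2]) else 0

variable {d : ℕ} {f : List ℕ → ℝ}

namespace InvWeight

lemma lang_of_pos (hf : InvWeight d f) {u : List ℕ} (h : 0 < f u) : Lang d u := by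
  by_contra hu
  exact h.ne' (hf.supp u hu)

lemma eq_zero_or_pos (hf : InvWeight d f) (u : List ℕ) : f u = 0 ∨ 0 < f u :=
  (hf.nonneg u).eq_or_lt.imp Eq.symm id

lemma append_singleton_le (hf : InvWeight d f) (hd : 3 ≤ d) (u : List ℕ) (a : ℕ) :
    f (u ++ [a]) ≤ f u := by
  rcases hf.eq_zero_or_pos (u ++ [a]) with h | h
  · exact h.trans_le (hf.nonneg _)
  · rw [hf.right u]
    exact single_le_sum (f := fun a => f (u ++ [a])) (fun _ _ => hf.nonneg _)
      (mem_Icc.2 (((hf.lang_of_pos h).admissible hd).1 a (by simp)))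

lemma cons_le (hf : InvWeight d f) (hd : 3 ≤ d) (u : List ℕ) (a : ℕ) : f (a :: u) ≤ f u := by
  rcases hf.eq_zero_or_pos (a :: u) with h | h
  · exact h.trans_le (hf.nonneg _)
  · rw [hf.left u]
    exact single_le_sum (f := fun a => f (a :: u)) (fun _ _ => hf.nonneg _)
      (mem_Icc.2 (((hf.lang_of_pos h).admissible hd).1 a (by simp)))

lemma le_of_isPrefix (hf : InvWeight d f) (hd : 3 ≤ d) {u v : List ℕ} (h : u <+: v) :
    f v ≤ f u := by
  obtain ⟨s, rfl⟩ := h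
  induction s generalizing u with
  | nil => simp
  | cons a s ih => simpa using (ih (u := u ++ [a])).trans (hf.append_singleton_le hd u a)

lemma le_of_isInfix (hf : InvWeight d f) (hd : 3 ≤ d) {u v : List ℕ} (h : u <:+: v) :
    f v ≤ f u := by
  obtain ⟨p, s, rfl⟩ := h
  refine (hf.le_of_isPrefix hd (List.prefix_append _ _)).trans ?_
  induction p with
  | nil => simp
  | cons a p ih => exact (hf.cons_le hd _ a).trans ih

lemma eq_zero_of_pair (hf : InvWeight d f) (hd : 3 ≤ d) {p s : List ℕ} {a b : ℕ} (h1 : b ≠ 1)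
    (h2 : b ≠ a + 1) : f (p ++ a :: b :: s) = 0 := by
  refine hf.supp _ fun h => ?_
  have := (h.admissible hd).pair
  tauto

lemma right_lt (hf : InvWeight d f) (hd : 3 ≤ d) (w : List ℕ) {t : ℕ} (ht : 1 ≤ t) (htd : t < d) :
    f (w ++ [t]) = f (w ++ [t, 1]) + f (w ++ [t, t + 1]) := by
  rw [hf.right, ← sum_subset (s₁ := {1, t + 1})]
  · rw [sum_pair (by omega)]; simp
  · intro x; simp; omega
  · intro x _ hx
    simp only [mem_insert, mem_singleton, not_or] at hx
    simpa using hf.eq_zero_of_pair hd (p := w) (s := []) hx.1 hx.2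

lemma right_last (hf : InvWeight d f) (hd : 3 ≤ d) (w : List ℕ) :
    f (w ++ [d]) = f (w ++ [d, 1]) := by
  rw [hf.right, sum_eq_single 1]
  · simp
  · intro x hx h1
    simpa using hf.eq_zero_of_pair hd (p := w) (s := []) h1 (by simp at hx; omega)
  · intro h; simp at h; omega

lemma left_succ (hf : InvWeight d f) (hd : 3 ≤ d) (w : List ℕ) {t : ℕ} (ht : 1 ≤ t) (htd : t < d) :
    f (t :: (t + 1) :: w) = f ((t + 1) :: w) := by
  rw [hf.left ((t + 1) :: w), sum_eq_single t]
  · intro x hx h1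
    simpa using hf.eq_zero_of_pair hd (p := []) (s := w) (b := t + 1) (a := x) (by omega) (by omega)
  · intro h; simp at h; omega

lemma sigTail_cons (hf : InvWeight d f) (hd : 3 ≤ d) (w : List ℕ) (a : ℕ) :
    f (sig d a ++ w) = f (sigTail d a :: w) := by
  rcases sig_cases d a with ⟨rfl, h⟩ | ⟨rfl, h⟩ | ⟨h1, h2, h⟩
  · rw [h, sigTail, if_neg (by omega)]
    exact hf.left_succ hd w le_rfl (by omega)
  · simp [h, sigTail]
  · simp [h, sigTail, h2]

lemma desub_eq (hd : 3 ≤ d) (hf : InvWeight d f) {u : List ℕ} (hu : ∀ a ∈ u, 1 ≤ a) :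
    desub d f u = ∑ a ∈ (Icc 1 d).erase 2, f (applySub (sig d) u ++ [a]) := by
  rw [desub, if_pos hu, hf.right (applySub (sig d) u),
    ← add_sum_erase _ _ (show 2 ∈ Icc 1 d by simp; omega)]
  ring

lemma desub_nonneg (hd : 3 ≤ d) (hf : InvWeight d f) (u : List ℕ) : 0 ≤ desub d f u := by
  by_cases hu : ∀ a ∈ u, 1 ≤ a
  · rw [hf.desub_eq hd hu]; exact sum_nonneg fun _ _ => hf.nonneg _
  · rw [desub, if_neg hu]

lemma desub_supp (hd : 3 ≤ d) (hf : InvWeight d f) (u : List ℕ) (h : ¬ Lang d u) :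
    desub d f u = 0 := by
  by_cases hu : ∀ a ∈ u, 1 ≤ a
  · rw [hf.desub_eq hd hu]
    refine sum_eq_zero fun a ha => hf.supp _ fun ⟨n, hn⟩ => h ⟨n, ?_⟩
    have hn' := hn.trans (sigIter_prefix_succ d n).isInfix
    rw [sigIter_succ] at hn'
    obtain ⟨p, s, hps⟩ := hn'
    refine infix_of_applySub_append hd hu (fun a ha => ((admissible_sigIter hd n).1 a ha).1)
      (p := p) (t := a :: s) ?_ (by simp) (by simp [← hps])
    simp at ha ⊢; omega
  · rw [desub, if_neg hu]

lemma sum_sigTail (hd : 3 ≤ d) (g : ℕ → ℝ) :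
    ∑ a ∈ Icc 1 d, g (sigTail d a) = ∑ a ∈ Icc 1 d, g a := by
  refine sum_nbij (sigTail d) ?_ ?_ ?_ fun _ _ => rfl
  · intro a ha
    rw [mem_Icc] at ha ⊢
    exact sigTail_mem hd ha.2
  · intro a ha b hb hab
    simp only [coe_Icc, Set.mem_Icc, sigTail] at ha hb hab
    split_ifs at hab <;> omega
  · intro a ha
    simp only [coe_Icc, Set.mem_Icc] at ha
    obtain ⟨b, h1, h2, h3⟩ := exists_sigTail_eq ha.1 ha.2
    exact ⟨b, by simp [h1, h2], h3⟩

lemma desub_cons (hd : 3 ≤ d) (hf : InvWeight d f) {u : List ℕ} (hu : ∀ a ∈ u, 1 ≤ a) {a : ℕ}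
    (ha : 1 ≤ a) : desub d f (a :: u) =
      f (sigTail d a :: applySub (sig d) u) - f (sigTail d a :: (applySub (sig d) u ++ [2])) := by
  rw [desub, if_pos (by simpa [ha] using hu), applySub, List.append_assoc,
    hf.sigTail_cons hd, hf.sigTail_cons hd]

lemma desub_append_singleton (hd : 3 ≤ d) (hf : InvWeight d f) {u : List ℕ}
    (hu : ∀ a ∈ u, 1 ≤ a) {a : ℕ} (ha : 1 ≤ a) (had : a < d) :
    desub d f (u ++ [a]) = f (applySub (sig d) (u ++ [a])) := by
  rw [desub, if_pos (by simp only [List.mem_append]; grind), sub_eq_self, applySub_append,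
    applySub_singleton]
  obtain ⟨w, hw⟩ := sig_eq_append_sigTail hd a
  rw [hw]
  simp only [List.append_assoc, List.cons_append, List.nil_append]
  rw [← List.append_assoc]
  refine hf.eq_zero_of_pair hd (by simp) ?_
  rw [sigTail, if_neg (by omega)]; omega

lemma desub_append_last (hd : 3 ≤ d) {u : List ℕ}
    (hu : ∀ a ∈ u, 1 ≤ a) :
    desub d f (u ++ [d]) = f (applySub (sig d) u ++ [1]) - f (applySub (sig d) u ++ [1, 2]) := by
  rw [desub, if_pos (by simp only [List.mem_append]; grind), applySub_append,
    applySub_singleton, sig_last hd]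
  simp

lemma desub_weight (hd : 3 ≤ d) (hf : InvWeight d f) : InvWeight d (desub d f) where
  nonneg := hf.desub_nonneg hd
  supp := hf.desub_supp hd
  right u := by
    by_cases hu : ∀ a ∈ u, 1 ≤ a
    · have e1 : (Icc 1 d).erase 2 = insert 1 (Ico 3 (d + 1)) := by ext; simp; omega
      have e2 : Icc 1 d = insert 1 (insert d (Ico 2 d)) := by ext; simp; omega
      have e3 : ∑ x ∈ Ico 2 d, desub d f (u ++ [x]) =
          ∑ x ∈ Ico 2 d, f (applySub (sig d) u ++ [x + 1]) := by
        refine sum_congr rfl fun x hx => ?_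
        rw [mem_Ico] at hx
        rw [hf.desub_append_singleton hd hu (by omega) (by omega), applySub_append,
          applySub_singleton, sig_mid (by omega) (by omega)]
      rw [hf.desub_eq hd hu, e1, e2, sum_insert (by simp), sum_insert (by simp; omega),
        sum_insert (by simp), hf.desub_append_singleton hd hu le_rfl (by omega),
        desub_append_last hd hu, applySub_append, applySub_singleton, sig_one,
        ← sum_Ico_add' (fun x => f (applySub (sig d) u ++ [x])) 2 d 1, e3]
      ring
    · rw [desub, if_neg hu]
      refine (sum_eq_zero fun a _ => ?_).symm
      rw [desub, if_neg fun h => hu fun a ha => h a (by simp [ha])]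
  left u := by
    by_cases hu : ∀ a ∈ u, 1 ≤ a
    · rw [sum_congr rfl fun a ha => hf.desub_cons hd hu (mem_Icc.1 ha).1, sum_sigTail hd fun a =>
        f (a :: applySub (sig d) u) - f (a :: (applySub (sig d) u ++ [2])), sum_sub_distrib,
        ← hf.left, ← hf.left, desub, if_pos hu]
    · rw [desub, if_neg hu]
      refine (sum_eq_zero fun a _ => ?_).symm
      rw [desub, if_neg fun h => hu fun a ha => h a (by simp [ha])]

end InvWeight

end Weights

section Renewal

open Finset Filter Topology

/-- The invariant of the recursion `y n = p * y (n + 1) + q * y (n + 1 + k)` with `p + q = 1`. -/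
def renewalSum (q : ℝ) (k : ℕ) (y : ℕ → ℝ) (n : ℕ) : ℝ :=
  y n + q * ∑ i ∈ range k, y (n + 1 + i)

lemma renewalSum_sub (q : ℝ) (k : ℕ) (y : ℕ → ℝ) (n : ℕ) :
    renewalSum q k y (n + 1) - renewalSum q k y n =
      (1 - q) * y (n + 1) + q * y (n + 1 + k) - y n := by
  have h : ∑ i ∈ range k, y (n + 1 + 1 + i) + y (n + 1) =
      ∑ i ∈ range k, y (n + 1 + i) + y (n + 1 + k) := by
    rw [← sum_range_succ, sum_range_succ']
    simp [add_left_comm, add_comm]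
  simp only [renewalSum]
  linear_combination q * h

variable {p q : ℝ} {k : ℕ} {y : ℕ → ℝ}

lemma renewalSum_sq_succ (hpq : p + q = 1) (hy : ∀ n, y n = p * y (n + 1) + q * y (n + 1 + k))
    (n : ℕ) : renewalSum q k (fun m => y m ^ 2) (n + 1) =
      renewalSum q k (fun m => y m ^ 2) n + p * q * (y (n + 1) - y (n + 1 + k)) ^ 2 := by
  have h := renewalSum_sub q k (fun m => y m ^ 2) n
  obtain rfl : p = 1 - q := by linarith
  simp only [hy n] at h
  linear_combination h

lemma renewalSum_le (hq : 0 ≤ q) {B : ℝ} (hB : ∀ n, y n ≤ B) (n : ℕ) :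
    renewalSum q k y n ≤ B + q * (k * B) := by
  have : ∑ i ∈ range k, y (n + 1 + i) ≤ k * B := by
    simpa using sum_le_card_nsmul (range k) (fun i => y (n + 1 + i)) B fun i _ => hB _
  unfold renewalSum
  gcongr
  exact hB n

lemma le_renewalSum (hq : 0 ≤ q) (hB : ∀ n, 0 ≤ y n) (n : ℕ) : y n ≤ renewalSum q k y n := by
  unfold renewalSum
  have := mul_nonneg hq (sum_nonneg fun i (_ : i ∈ range k) => hB (n + 1 + i))
  linarith

lemma renewal_sq_monotone (hp : 0 < p) (hq : 0 < q) (hpq : p + q = 1)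
    (hy : ∀ n, y n = p * y (n + 1) + q * y (n + 1 + k)) :
    Monotone (renewalSum q k fun m => y m ^ 2) :=
  monotone_nat_of_le_succ fun n => by
    rw [renewalSum_sq_succ hpq hy]
    exact le_add_of_nonneg_right (by positivity)

/-- A nonnegative sequence with `y n = p * y (n + 1) + q * y (n + 1 + k)` is constant. -/
lemma renewal_constant (hp : 0 < p) (hq : 0 < q) (hpq : p + q = 1)
    (hy : ∀ n, y n = p * y (n + 1) + q * y (n + 1 + k)) (h0 : ∀ n, 0 ≤ y n) (n : ℕ) :
    y n = y 0 := by
  set C := renewalSum q k y 0 with hC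
  have hconst : ∀ n, renewalSum q k y n = C := by
    intro n
    induction n with
    | zero => rfl
    | succ n ih =>
      have := renewalSum_sub q k y n
      rw [hy n] at this
      rw [← ih]
      linear_combination this - y (n + 1) * hpq
  have hle : ∀ n, y n ≤ C := fun n => (le_renewalSum hq.le h0 n).trans (hconst n).le
  have hmono := renewal_sq_monotone hp hq hpq hy
  obtain ⟨L, hL⟩ : ∃ L, Tendsto (renewalSum q k fun m => y m ^ 2) atTop (𝓝 L) := by
    refine ⟨_, tendsto_atTop_ciSup hmono ⟨C ^ 2 + q * (k * C ^ 2), ?_⟩⟩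
    rintro _ ⟨n, rfl⟩
    exact renewalSum_le hq.le (fun n => pow_le_pow_left₀ (h0 n) (hle n) 2) n
  have hdiff : Tendsto (fun n => (y (n + 1 + k) - y (n + 1))) atTop (𝓝 0) := by
    have h1 := ((tendsto_add_atTop_iff_nat 1).2 hL).sub hL
    have h2 : Tendsto (fun n => (y (n + 1 + k) - y (n + 1)) ^ 2) atTop (𝓝 0) := by
      have := h1.const_mul (p * q)⁻¹
      simp only [sub_self, mul_zero] at this
      refine this.congr fun n => ?_
      rw [renewalSum_sq_succ hpq hy]
      have := (mul_pos hp hq).ne'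
      field_simp
      ring
    have h3 := (h2.sqrt)
    simp only [Real.sqrt_sq_eq_abs, Real.sqrt_zero] at h3
    exact (tendsto_zero_iff_abs_tendsto_zero _).2 h3
  have hdiff : Tendsto (fun n => y (n + 1) - y n) atTop (𝓝 0) := by
    have := hdiff.const_mul (-q)
    rw [mul_zero] at this
    refine this.congr fun n => ?_
    rw [hy n]
    linear_combination (y (n + 1)) * hpq
  have hshift : ∀ i, Tendsto (fun n => y (n + i) - y n) atTop (𝓝 0) := by
    intro i
    induction i with
    | zero => simp
    | succ i ih =>
      have := ((tendsto_add_atTop_iff_nat i).2 hdiff).add ih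
      rw [add_zero] at this
      exact this.congr fun n => by rw [← add_assoc]; ring
  have hk : 0 < 1 + q * k := by positivity
  obtain ⟨l, hl⟩ : ∃ l, Tendsto y atTop (𝓝 l) := by
    refine ⟨(1 + q * k)⁻¹ * (C - q * ∑ i ∈ range k, 0), ?_⟩
    have := (((tendsto_finsetSum (range k) fun i _ => hshift (1 + i)).const_mul q).const_sub
      C).const_mul (1 + q * k)⁻¹
    refine this.congr fun n => ?_
    rw [← hconst n, renewalSum, sum_sub_distrib]
    simp only [add_assoc, sum_const, card_range, nsmul_eq_mul]
    field_simp
    ring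
  have hu : ∀ n, y n - l = p * (y (n + 1) - l) + q * (y (n + 1 + k) - l) := fun n => by
    rw [hy n]; linear_combination l * hpq
  have hmono' := renewal_sq_monotone (y := fun n => y n - l) hp hq hpq hu
  have hlim : Tendsto (renewalSum q k fun n => (y n - l) ^ 2) atTop (𝓝 0) := by
    have h1 : Tendsto (fun n => (y n - l) ^ 2) atTop (𝓝 0) := by
      simpa using (hl.sub_const l).pow 2
    have h2 : ∀ i, Tendsto (fun n => (y (n + 1 + i) - l) ^ 2) atTop (𝓝 0) := fun i => by
      simpa [add_assoc] using (tendsto_add_atTop_iff_nat (1 + i)).2 h1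
    have := h1.add ((tendsto_finsetSum (range k) fun i _ => h2 i).const_mul q)
    simp only [sum_const_zero, mul_zero, add_zero] at this
    exact this
  have hzero : ∀ n, y n = l := fun n => by
    have h1 := hmono'.ge_of_tendsto hlim n
    have h2 := le_renewalSum (k := k) hq.le (y := fun n => (y n - l) ^ 2) (fun _ => sq_nonneg _) n
    have h3 : (y n - l) ^ 2 = 0 := le_antisymm (h2.trans h1) (sq_nonneg _)
    exact sub_eq_zero.1 (pow_eq_zero_iff two_ne_zero |>.1 h3)
  rw [hzero n, hzero 0]

lemma exists_root_add_pow {d : ℕ} (hd : 3 ≤ d) : ∃ r : ℝ, 0 < r ∧ r < 1 ∧ r + r ^ d = 1 := by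
  have hc : ContinuousOn (fun r : ℝ => r + r ^ d) (Set.Icc 0 1) := by fun_prop
  obtain ⟨r, ⟨h0, h1⟩, hr⟩ := intermediate_value_Icc zero_le_one hc
    (show (1 : ℝ) ∈ _ by simp [show d ≠ 0 by omega])
  simp only at hr
  refine ⟨r, h0.lt_of_ne ?_, h1.lt_of_ne ?_, hr⟩
  · rintro rfl
    simp [show d ≠ 0 by omega] at hr
  · rintro rfl
    simp at hr

end Renewal

section Letters

open Finset

namespace InvWeight

variable {d : ℕ} {f : List ℕ → ℝ} {r : ℝ}

lemma iterate_desub (hd : 3 ≤ d) (hf : InvWeight d f) (n : ℕ) :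
    InvWeight d ((desub d)^[n] f) := by
  induction n with
  | zero => exact hf
  | succ n ih => rw [Function.iterate_succ_apply']; exact ih.desub_weight hd

lemma desub_letter (hd : 3 ≤ d) (hf : InvWeight d f) {a : ℕ} (ha : 1 ≤ a) (had : a < d) :
    desub d f [a] = f [a + 1] := by
  have h := hf.desub_append_singleton hd (u := []) (by simp) ha had
  simp only [List.nil_append, applySub_singleton] at h
  have h' := hf.sigTail_cons hd [] a
  rw [List.append_nil, sigTail, if_neg had.ne] at h'
  rw [h, h']

lemma desub_letter_last (hd : 3 ≤ d) (hf : InvWeight d f) : desub d f [d] = f [1] - f [2] := by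
  have h := desub_append_last (f := f) hd (u := []) (by simp)
  simp only [List.nil_append, applySub] at h
  rw [h, hf.left_succ hd [] le_rfl (by omega)]

lemma iterate_letter (hd : 3 ≤ d) (hf : InvWeight d f) {a : ℕ} (ha : a < d) (n : ℕ) :
    (desub d)^[n] f [a + 1] = (desub d)^[n + a] f [1] := by
  induction a generalizing n with
  | zero => rfl
  | succ a ih =>
    rw [← (hf.iterate_desub hd n).desub_letter hd (by omega) ha,
      ← Function.iterate_succ_apply' (desub d), ih (by omega), Nat.succ_add_eq_add_succ]

lemma desub_one (hd : 3 ≤ d) (hr0 : 0 < r) (hr : r + r ^ d = 1) (hf : InvWeight d f) :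
    desub d f [1] = f [1] * r := by
  obtain ⟨k, rfl⟩ := Nat.exists_eq_add_of_le' (show 1 ≤ d by omega)
  set x : ℕ → ℝ := fun n => (desub (k + 1))^[n] f [1] with hx
  have hrec : ∀ n, x n = x (n + 1) + x (n + 1 + k) := fun n => by
    have h1 := (hf.iterate_desub hd n).desub_letter_last hd
    rw [← Function.iterate_succ_apply' (desub _), hf.iterate_letter hd (by omega),
      hf.iterate_letter hd (a := 1) (by omega)] at h1
    simp only [hx]
    linarith
  have := renewal_constant (y := fun n => x n / r ^ n) (k := k) hr0 (pow_pos hr0 _) hr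
    (fun n => by
      rw [hrec n, pow_add, pow_add, pow_add]
      have := hr0.ne'
      field_simp
      ring)
    (fun n => div_nonneg ((hf.iterate_desub hd n).nonneg _) (by positivity)) 1
  simp only [hx, Function.iterate_one, Function.iterate_zero, id, pow_one, pow_zero, div_one]
    at this
  rwa [div_eq_iff hr0.ne'] at this

lemma letter (hd : 3 ≤ d) (hr0 : 0 < r) (hr : r + r ^ d = 1) (hf : InvWeight d f) {a : ℕ}
    (ha : a < d) : f [a + 1] = f [1] * r ^ a := by
  induction a generalizing f with
  | zero => simp
  | succ a ih =>
    rw [← hf.desub_letter hd (by omega) ha, ih (hf.desub_weight hd) (by omega),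
      hf.desub_one hd hr0 hr, pow_succ']
    ring

end InvWeight

end Letters

section Descent

namespace InvWeight

variable {d : ℕ} {f : List ℕ → ℝ}

lemma desub_of_last_lt (hd : 3 ≤ d) (hf : InvWeight d f) {z w : List ℕ} (hz : ∀ a ∈ z, 1 ≤ a)
    (hw : ∀ a ∈ w, 1 ≤ a) {t : ℕ} (ht : 1 ≤ t) (htd : t < d) :
    desub d f (z ++ (w ++ [t])) = f (applySub (sig d) z ++ applySub (sig d) (w ++ [t])) := by
  rw [← applySub_append, ← List.append_assoc,
    hf.desub_append_singleton hd (by simp only [List.mem_append]; grind) ht htd]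

lemma desub_of_le_last (hd : 3 ≤ d) (hf : InvWeight d f) {z w : List ℕ} (hz : ∀ a ∈ z, 1 ≤ a)
    (hw : ∀ a ∈ w, 1 ≤ a) {t : ℕ} (ht : d ≤ t + 1) (htd : t ≤ d) :
    desub d f (z ++ (w ++ [t])) =
      f (applySub (sig d) z ++ (applySub (sig d) (w ++ [t]) ++ [1])) := by
  rw [← List.append_assoc, ← List.append_assoc, ← applySub_append, ← List.append_assoc]
  have hzw : ∀ a ∈ z ++ w, 1 ≤ a := by simp only [List.mem_append]; grind
  rcases htd.eq_or_lt with rfl | h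
  · rw [desub_append_last hd hzw, applySub_append _ _ [t], applySub_singleton, sig_last hd,
      hf.right_lt hd _ le_rfl (by omega)]
    simp
  · rw [hf.desub_append_singleton hd hzw (by omega) h, applySub_append _ _ [t],
      applySub_singleton, sig_mid (by omega) (by omega), show t + 1 = d by omega,
      hf.right_last hd]
    simp

lemma desub_append_one (hd : 3 ≤ d) (hf : InvWeight d f) {z w : List ℕ} (hz : ∀ a ∈ z, 1 ≤ a)
    (hw : ∀ a ∈ w, 1 ≤ a) {t : ℕ} (ht : 1 ≤ t) (htd : t + 2 ≤ d) :
    desub d f (z ++ (w ++ [t] ++ [1])) =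
      f (applySub (sig d) z ++ (applySub (sig d) (w ++ [t]) ++ [1])) := by
  have hzw : ∀ a ∈ z ++ (w ++ [t]), 1 ≤ a := by simp only [List.mem_append]; grind
  have h1 := hf.right_lt hd (applySub (sig d) (z ++ (w ++ [t]))) le_rfl (by omega)
  have h2 := desub_append_last (f := f) hd hzw
  have h3 : desub d f (z ++ (w ++ [t]) ++ [d]) = 0 := by
    have := (hf.desub_weight hd).eq_zero_of_pair hd (p := z ++ w) (s := []) (a := t) (b := d)
      (by omega) (by omega)
    simpa using this
  have h4 : f (applySub (sig d) (z ++ (w ++ [t])) ++ [1, 1]) = 0 := by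
    have := (hf.nonneg (applySub (sig d) (z ++ (w ++ [t])) ++ [1, 1]))
    norm_num at h1
    linarith
  have h5 := hf.desub_append_singleton hd hzw le_rfl (show 1 < d by omega)
  rw [applySub_append _ _ [1], applySub_singleton, sig_one] at h5
  have h6 : z ++ (w ++ [t] ++ [1]) = z ++ (w ++ [t]) ++ [1] := by simp
  rw [h6, h5, ← List.append_assoc (applySub _ z), ← applySub_append, h1, h4, zero_add]

end InvWeight

variable {d : ℕ} {ω : ℕ → ℕ} {f : List ℕ → ℝ}

lemma IsSigmaFixedPoint.one_le_of_mem (hω : IsSigmaFixedPoint d ω) (hd : 3 ≤ d) (p n : ℕ) :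
    ∀ a ∈ factorAt ω p n, 1 ≤ a := fun a ha =>
  (((hω.lang_factorAt p n).admissible hd).1 a ha).1

/-- Every prefix of length at least two is obtained, for the purpose of weights, by
substituting a shorter prefix. -/
lemma IsSigmaFixedPoint.exists_desub_eq (hω : IsSigmaFixedPoint d ω) (hd : 3 ≤ d) {n : ℕ}
    (hn : 2 ≤ n) : ∃ j, 1 ≤ j ∧ j < n ∧ ∀ f, InvWeight d f → ∀ z : List ℕ, (∀ a ∈ z, 1 ≤ a) →
      desub d f (z ++ factorAt ω 0 j) = f (applySub (sig d) z ++ factorAt ω 0 n) := by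
  set N : ℕ → ℕ := fun j => (applySub (sig d) (factorAt ω 0 j)).length with hN
  have hlt : ∀ j, j + 1 < N (j + 1) := fun j => by
    have := length_lt_length_applySub d (factorAt ω 1 j)
    simpa [hN, factorAt_succ', hω.zero_eq] using this
  have hσ : ∀ j, applySub (sig d) (factorAt ω 0 j) = factorAt ω 0 (N j) := hω.applySub_eq
  have hmem := hω.one_le_of_mem hd 0
  obtain ⟨j, hj1, hj2⟩ : ∃ j, N (j + 1) ≤ n ∧ n < N (j + 1 + 1) := by
    have hex : ∃ j, n < N (j + 1) := ⟨n, by have := hlt n; omega⟩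
    have hpos : Nat.find hex ≠ 0 := fun h0 => by
      have := Nat.find_spec hex
      rw [h0] at this
      simp [hN, factorAt_succ, hω.zero_eq, applySub, sig] at this
      omega
    obtain ⟨j, hj⟩ := Nat.exists_eq_succ_of_ne_zero hpos
    refine ⟨j, not_lt.1 (Nat.find_min hex (m := j) (by omega)), ?_⟩
    have := Nat.find_spec hex
    rwa [hj] at this
  have hP : factorAt ω 0 (j + 1) = factorAt ω 0 j ++ [ω j] := by
    rw [factorAt_succ, zero_add]
  have hP' : factorAt ω 0 (j + 1 + 1) = factorAt ω 0 (j + 1) ++ [ω (j + 1)] := by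
    rw [factorAt_succ _ _ (j + 1), zero_add]
  have hωj := hω.one_le hd j
  have hjn := hlt j
  rcases hj1.eq_or_lt with h | h
  · rcases hωj.2.eq_or_lt with hjd | hjd
    · obtain ⟨i, rfl⟩ : ∃ i, j = i + 1 := Nat.exists_eq_succ_of_ne_zero fun h0 => by
        rw [h0, hω.zero_eq] at hjd; omega
      have hi := hω.succ_eq hd i
      refine ⟨i + 1, by omega, by omega, fun f hf z hz => ?_⟩
      have hn' : factorAt ω 0 n = applySub (sig d) (factorAt ω 0 (i + 1)) ++ [1] := by
        rw [← h, ← hσ, hP, applySub_append, applySub_singleton, hjd, sig_last hd]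
      rw [hn', factorAt_succ, zero_add]
      exact hf.desub_of_le_last hd hz (hmem _) (by omega) (hω.one_le hd i).2
    · refine ⟨j + 1, by omega, by omega, fun f hf z hz => ?_⟩
      rw [← h, ← hσ, hP]
      exact hf.desub_of_last_lt hd hz (hmem _) hωj.1 hjd
  · have hs : N (j + 1 + 1) = N (j + 1) + (sig d (ω (j + 1))).length := by
      simp only [hN]
      rw [hP', applySub_append, List.length_append, applySub_singleton]
    obtain ⟨hone, hn1⟩ : ω (j + 1) = 1 ∧ n = N (j + 1) + 1 := by
      rcases sig_cases d (ω (j + 1)) with ⟨h1, h2⟩ | ⟨h1, h2⟩ | ⟨h1, h3, h2⟩ <;>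
        simp only [h2, List.length_cons, List.length_nil] at hs <;> omega
    have hn' : factorAt ω 0 n = applySub (sig d) (factorAt ω 0 (j + 1)) ++ [1] := by
      have h1 : factorAt ω 0 (j + 1 + 1) = factorAt ω 0 (j + 1) ++ [1] := by rw [hP', hone]
      have h2 := hσ (j + 1 + 1)
      rw [h1, applySub_append, applySub_singleton, sig_one] at h2
      have h3 := eq_factorAt_of_isPrefix (u := applySub (sig d) (factorAt ω 0 (j + 1)) ++ [1])
        (ω := ω) (q := 0) (n := N (j + 1 + 1)) (by rw [← h2]; exact ⟨[2], by simp⟩)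
      rw [h3, hn1]
      simp [hN]
    rcases le_or_gt d (ω j + 1) with hjd | hjd
    · refine ⟨j + 1, by omega, by omega, fun f hf z hz => ?_⟩
      rw [hn', hP]
      exact hf.desub_of_le_last hd hz (hmem _) hjd hωj.2
    · refine ⟨j + 1 + 1, by omega, by omega, fun f hf z hz => ?_⟩
      rw [hn', hP', hone, hP]
      exact hf.desub_append_one hd hz (hmem _) hωj.1 (by omega)

/-- An admissible word not starting with `2` is, up to a final letter `1`, the image of a word
under the substitution. -/
lemma Admissible.exists_desubstitution (hd : 3 ≤ d) {u : List ℕ} (hu : Admissible d u)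
    (h2 : u.head? ≠ some 2) : ∃ v, (∀ a ∈ v, 1 ≤ a ∧ a ≤ d) ∧
      ((u = _root_.applySub (sig d) v ∧ ∀ w t, v = w ++ [t] → t ≠ d) ∨
        u = _root_.applySub (sig d) v ++ [1]) := by
  induction u using List.reverseRecOn with
  | nil => exact ⟨[], by simp, .inl ⟨rfl, by simp⟩⟩
  | append_singleton p x ih =>
    have hx : 1 ≤ x ∧ x ≤ d := hu.1 x (by simp)
    rcases List.eq_nil_or_concat p with rfl | ⟨q, y, rfl⟩
    · have hx2 : x ≠ 2 := by simpa using h2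
      rcases hx.1.eq_or_lt with rfl | h1
      · exact ⟨[], by simp, .inr rfl⟩
      · refine ⟨[x - 1], by simp; omega, .inl ⟨?_, fun w t h => ?_⟩⟩
        · rw [applySub_singleton, sig_mid (by omega) (by omega)]
          simp; omega
        · have := (List.append_inj' (s₁ := []) h rfl).2
          simp at this; omega
    · rw [List.concat_eq_append] at *
      obtain ⟨v, hv, h⟩ := ih (hu.of_isInfix (List.prefix_append _ _).isInfix)
        (by cases q <;> simpa using h2)
      have hxy : x = 1 ∨ x = y + 1 := Admissible.pair (p := q) (s := []) (by simpa using hu)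
      rcases hxy with rfl | rfl
      · rcases h with ⟨h, -⟩ | h
        · exact ⟨v, hv, .inr (by rw [h])⟩
        · refine ⟨v ++ [d], fun a ha => ?_, .inr ?_⟩
          · rcases List.mem_append.1 ha with ha | ha
            · exact hv a ha
            · simp at ha; omega
          · rw [h, applySub_append, applySub_singleton, sig_last hd]
      · rcases h with ⟨h, hlast⟩ | h
        · rcases List.eq_nil_or_concat v with rfl | ⟨w, t, rfl⟩
          · simp [_root_.applySub] at h
          · rw [List.concat_eq_append] at *
            have ht := hlast w t rfl
            have ht1 := (hv t (by simp)).1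
            obtain ⟨s, hs⟩ := sig_eq_append_sigTail hd t
            have hy := h
            rw [applySub_append, applySub_singleton, hs, ← List.append_assoc] at hy
            have hy := (List.append_inj' hy rfl).2
            simp only [sigTail, if_neg ht, List.cons.injEq, and_true] at hy
            refine ⟨w ++ [t] ++ [y], fun a ha => ?_, .inl ⟨?_, fun w' t' h' => ?_⟩⟩
            · rcases List.mem_append.1 ha with ha | ha
              · exact hv a ha
              · simp at ha; omega
            · rw [applySub_append _ _ [y], applySub_singleton, sig_mid (by omega) (by omega), h]
            · have := (List.append_inj' h' rfl).2
              simp at this; omega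
        · obtain ⟨hq, hy⟩ := List.append_inj' h rfl
          simp at hy
          subst hy
          refine ⟨v ++ [1], fun a ha => ?_, .inl ⟨?_, fun w' t' h' => ?_⟩⟩
          · rcases List.mem_append.1 ha with ha | ha
            · exact hv a ha
            · simp at ha; omega
          · rw [applySub_append, applySub_singleton, sig_one, hq]; simp
          · have := (List.append_inj' h' rfl).2
            simp at this; omega

lemma InvWeight.head_eq_one (hf : InvWeight d f) (hd : 3 ≤ d) {c a b : ℕ} {u : List ℕ}
    (hab : a ≠ b) (ha : 0 < f (a :: c :: u)) (hb : 0 < f (b :: c :: u)) : c = 1 := by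
  have h1 := ((hf.lang_of_pos ha).admissible hd).pair (p := [])
  have h2 := ((hf.lang_of_pos hb).admissible hd).pair (p := [])
  omega

/-- Weighted left-special words are prefixes of the fixed point. -/
lemma InvWeight.eq_prefix_of_leftSpecial (hω : IsSigmaFixedPoint d ω) (hd : 3 ≤ d)
    (hf : InvWeight d f) {u : List ℕ} {a b : ℕ} (hab : a ≠ b) (ha : 0 < f (a :: u))
    (hb : 0 < f (b :: u)) : u = factorAt ω 0 u.length := by
  induction hlen : u.length using Nat.strong_induction_on generalizing f u a b with
  | _ n ih =>
  subst hlen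
  have hLa := (hf.lang_of_pos ha).admissible hd
  have hLb := (hf.lang_of_pos hb).admissible hd
  obtain ⟨a', ha1, had, rfl⟩ := exists_sigTail_eq (hLa.1 a (by simp)).1 (hLa.1 a (by simp)).2
  obtain ⟨b', hb1, hbd, rfl⟩ := exists_sigTail_eq (hLb.1 b (by simp)).1 (hLb.1 b (by simp)).2
  have hab' : a' ≠ b' := fun h => hab (by rw [h])
  have hu : Admissible d u := hLa.of_isInfix (List.suffix_cons _ _).isInfix
  have hone : ∀ c w, u = c :: w → c = 1 := by
    rintro c w rfl
    exact hf.head_eq_one hd hab ha hb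
  have hhead : u.head? ≠ some 2 := by
    cases u with
    | nil => simp
    | cons c w => simp [hone c w rfl]
  have hcons : ∀ s : List ℕ, ∀ a, f (applySub (sig d) [a] ++ s) = f (sigTail d a :: s) := by
    intro s a
    rw [applySub_singleton, hf.sigTail_cons hd]
  have key : ∀ v : List ℕ, v ≠ [] → (∀ x ∈ v, 1 ≤ x) → (∀ w, v = 1 :: w → v.length < u.length) →
      (∀ a, 1 ≤ a → desub d f ([a] ++ v) = f (applySub (sig d) [a] ++ u)) →
      v = factorAt ω 0 v.length := by
    intro v hv0 hv hl h
    have hva : 0 < desub d f (a' :: v) := by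
      rw [← List.singleton_append, h _ ha1, hcons]; exact ha
    have hvb : 0 < desub d f (b' :: v) := by
      rw [← List.singleton_append, h _ hb1, hcons]; exact hb
    obtain ⟨c, w, rfl⟩ := List.exists_cons_of_ne_nil hv0
    obtain rfl := (hf.desub_weight hd).head_eq_one hd hab' hva hvb
    exact ih _ (hl w rfl) (hf.desub_weight hd) hab' hva hvb rfl
  have hsing : ∀ a : ℕ, 1 ≤ a → ∀ x ∈ [a], 1 ≤ x := by simp
  obtain ⟨v, hv, ⟨h, hlast⟩ | h⟩ := hu.exists_desubstitution hd hhead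
  · rcases List.eq_nil_or_concat v with rfl | ⟨w, t, rfl⟩
    · simp [h, applySub]
    · rw [List.concat_eq_append] at *
      have hw : ∀ x ∈ w, 1 ≤ x := fun x hx => (hv x (by simp [hx])).1
      have ht := hv t (by simp)
      have hv' := key (w ++ [t]) (by simp) (fun x hx => (hv x hx).1)
        (fun s hs => by rw [h, hs]; exact length_lt_length_applySub d s)
        fun a ha => by rw [h, hf.desub_of_last_lt hd (hsing a ha) hw ht.1 (by grind)]
      rw [hv', hω.applySub_eq] at h
      rw [h, length_factorAt]
  · rcases List.eq_nil_or_concat v with rfl | ⟨w, t, rfl⟩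
    · simp [h, applySub, factorAt_succ, hω.zero_eq]
    · rw [List.concat_eq_append] at *
      have hw : ∀ x ∈ w, 1 ≤ x := fun x hx => (hv x (by simp [hx])).1
      have ht := hv t (by simp)
      rcases le_or_gt d (t + 1) with htd | htd
      · have hv' := key (w ++ [t]) (by simp) (fun x hx => (hv x hx).1)
          (fun s hs => by
            rw [h, hs, List.length_append]
            exact (length_lt_length_applySub d s).trans (Nat.lt_succ_self _))
          fun a ha => by rw [h, hf.desub_of_le_last hd (hsing a ha) hw htd ht.2]
        have hP : factorAt ω 0 (w.length + 1 + 1) = w ++ [t] ++ [ω (w.length + 1)] := by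
          rw [factorAt_succ, zero_add, hv']; simp
        have hωw : ω w.length = t := by
          have := hv'
          rw [List.length_append, List.length_singleton, factorAt_succ, zero_add] at this
          simpa using (List.append_inj' this rfl).2.symm
        obtain ⟨s, hs⟩ : ∃ s, sig d (ω (w.length + 1)) = [1] ++ s := by
          have h1 := hω.succ_eq hd w.length
          have h2 := (hω.one_le hd (w.length + 1)).2
          rcases h1 with h1 | h1
          · exact ⟨[2], by rw [h1]; simp [sig_one]⟩
          · exact ⟨[], by rw [show ω (w.length + 1) = d by omega, sig_last hd]; simp⟩
        have hσ := hω.applySub_eq (w.length + 1 + 1)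
        rw [hP, applySub_append _ _ [_], applySub_singleton, hs, ← List.append_assoc, ← h] at hσ
        exact eq_factorAt_of_isPrefix (hσ ▸ List.prefix_append _ _)
      · have hv' := key (w ++ [t] ++ [1]) (by simp) (by simp only [List.mem_append]; grind)
          (fun s hs => by
            obtain ⟨x, r, hxr⟩ := List.exists_cons_of_ne_nil
              (show w ++ [t] ≠ [] by simp)
            rw [hxr] at hs
            obtain rfl : x = 1 := by simpa using congrArg List.head? hs
            rw [h, hxr, List.length_append, List.length_append]
            exact Nat.add_lt_add_right (length_lt_length_applySub d r) 1)
          fun a ha => by rw [h, hf.desub_append_one hd (hsing a ha) hw ht.1 htd]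
        have hσ := hω.applySub_eq (w ++ [t] ++ [1]).length
        rw [← hv', applySub_append _ _ [1], applySub_singleton, sig_one,
          show [1, 2] = [1] ++ [2] from rfl, ← List.append_assoc, ← h] at hσ
        exact eq_factorAt_of_isPrefix (hσ ▸ List.prefix_append _ _)

end Descent

section Exponents

variable {d : ℕ} {ω : ℕ → ℕ} {f : List ℕ → ℝ} {r : ℝ}

namespace InvWeight

lemma letter_cons_one (hd : 3 ≤ d) (hr0 : 0 < r) (hr : r + r ^ d = 1) (hf : InvWeight d f) {a : ℕ}
    (ha : a + 1 < d) : f [a + 1, 1] = f [1] * r ^ (a + d) := by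
  have h1 := hf.right_lt hd [] (t := a + 1) (by omega) ha
  have h2 := hf.left_succ hd [] (t := a + 1) (by omega) ha
  simp only [List.nil_append] at h1
  rw [h2, hf.letter hd hr0 hr (by omega), hf.letter hd hr0 hr ha] at h1
  rw [pow_add, show r ^ d = 1 - r by linarith]
  rw [pow_succ] at h1
  linear_combination -h1

lemma last_cons_one (hd : 3 ≤ d) (hr0 : 0 < r) (hr : r + r ^ d = 1) (hf : InvWeight d f) :
    f [d, 1] = f [1] * r ^ (d - 1) := by
  have h := hf.letter hd hr0 hr (a := d - 1) (by omega)
  rw [Nat.sub_add_cancel (by omega)] at h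
  rw [← h]
  exact (hf.right_last hd []).symm

lemma image_cons_one (hd : 3 ≤ d) (hr0 : 0 < r) (hr : r + r ^ d = 1) (hf : InvWeight d f) :
    (fun a => f [a, 1]) '' Set.Icc 1 d =
      (fun i => f [1] * r ^ i) '' Set.Icc (d - 1) (2 * d - 2) := by
  ext x
  constructor
  · rintro ⟨a, ⟨ha1, had⟩, rfl⟩
    rcases had.eq_or_lt with rfl | h
    · exact ⟨a - 1, ⟨le_rfl, by omega⟩, (hf.last_cons_one hd hr0 hr).symm⟩
    · obtain ⟨a, rfl⟩ := Nat.exists_eq_add_of_le' ha1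
      exact ⟨a + d, ⟨by omega, by omega⟩, (hf.letter_cons_one hd hr0 hr h).symm⟩
  · rintro ⟨i, ⟨hi1, hi2⟩, rfl⟩
    rcases hi1.eq_or_lt with rfl | h
    · exact ⟨d, ⟨by omega, le_rfl⟩, hf.last_cons_one hd hr0 hr⟩
    · obtain ⟨a, rfl⟩ := Nat.exists_eq_add_of_le' (show d ≤ i by omega)
      exact ⟨a + 1, ⟨by omega, by omega⟩, hf.letter_cons_one hd hr0 hr (by omega)⟩

end InvWeight

/-- The measures of a prefix of the fixed point and of its left extensions. -/
lemma IsSigmaFixedPoint.exists_exponent (hω : IsSigmaFixedPoint d ω) (hd : 3 ≤ d) (hr0 : 0 < r)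
    (hr : r + r ^ d = 1) (n : ℕ) : ∃ e, ∀ f, InvWeight d f →
      f (factorAt ω 0 (n + 1)) = f [1] * r ^ e ∧
      (fun a => f (a :: factorAt ω 0 (n + 1))) '' Set.Icc 1 d =
        (fun i => f [1] * r ^ i) '' Set.Icc (e + (d - 1)) (e + (2 * d - 2)) := by
  induction n using Nat.strong_induction_on with
  | _ n ih =>
  rcases Nat.eq_zero_or_pos n with rfl | hn
  · refine ⟨0, fun f hf => ?_⟩
    have := hf.image_cons_one hd hr0 hr
    simpa [factorAt_succ, factorAt_zero, hω.zero_eq] using this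
  · obtain ⟨j, hj1, hj2, hj⟩ := hω.exists_desub_eq hd (n := n + 1) (by omega)
    obtain ⟨j, rfl⟩ := Nat.exists_eq_add_of_le' hj1
    obtain ⟨e, he⟩ := ih j (by omega)
    refine ⟨e + 1, fun f hf => ?_⟩
    obtain ⟨h1, h2⟩ := he _ (hf.desub_weight hd)
    have h0 := hj f hf [] (by simp)
    simp only [List.nil_append, applySub] at h0
    have hcons : ∀ a, 1 ≤ a → desub d f (a :: factorAt ω 0 (j + 1)) =
        f (sigTail d a :: factorAt ω 0 (n + 1)) := fun a ha => by
      rw [← List.singleton_append, hj f hf [a] (by simpa using ha), applySub_singleton,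
        hf.sigTail_cons hd]
    have hpow : ∀ i, f [1] * r * r ^ i = f [1] * r ^ (i + 1) := fun i => by ring
    rw [hf.desub_one hd hr0 hr] at h1 h2
    simp only [hpow] at h1 h2
    refine ⟨h0 ▸ h1, ?_⟩
    rw [show e + 1 + (d - 1) = e + (d - 1) + 1 by omega,
      show e + 1 + (2 * d - 2) = e + (2 * d - 2) + 1 by omega, ← Set.image_add_const_Icc,
      Set.image_image, ← h2]
    ext x
    constructor
    · rintro ⟨a, ⟨ha1, had⟩, rfl⟩
      obtain ⟨b, hb1, hbd, rfl⟩ := exists_sigTail_eq ha1 had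
      exact ⟨b, ⟨hb1, hbd⟩, hcons b hb1⟩
    · rintro ⟨a, ⟨ha1, had⟩, rfl⟩
      exact ⟨sigTail d a, sigTail_mem hd had, (hcons a ha1).symm⟩

end Exponents

section Values

/-- The values taken by a weight on the words of length `n` of the language. -/
def weightValues (d : ℕ) (f : List ℕ → ℝ) (n : ℕ) : Set ℝ :=
  {x | ∃ u : List ℕ, Lang d u ∧ u.length = n ∧ f u = x}

/-- The weights of the nonempty prefixes of `ω`, and of their left extensions, are powers of `r`
with exponents governed by `e`. -/
structure PrefixExponents (d : ℕ) (ω : ℕ → ℕ) (f : List ℕ → ℝ) (r : ℝ) (e : ℕ → ℕ) : Prop where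
  value : ∀ n, f (factorAt ω 0 (n + 1)) = f [1] * r ^ e n
  image : ∀ n, (fun a => f (a :: factorAt ω 0 (n + 1))) '' Set.Icc 1 d =
    (fun i => f [1] * r ^ i) '' Set.Icc (e n + (d - 1)) (e n + (2 * d - 2))

variable {d : ℕ} {ω : ℕ → ℕ} {f : List ℕ → ℝ} {r : ℝ} {e : ℕ → ℕ}

namespace InvWeight

lemma exists_cons_pos (hf : InvWeight d f) {u : List ℕ} (hu : 0 < f u) :
    ∃ a, 1 ≤ a ∧ a ≤ d ∧ 0 < f (a :: u) := by
  by_contra! h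
  refine hu.ne' ?_
  rw [hf.left u]
  refine Finset.sum_eq_zero fun a ha => ?_
  rw [Finset.mem_Icc] at ha
  exact (h a ha.1 ha.2).antisymm (hf.nonneg _)

lemma cons_eq_of_ne (hω : IsSigmaFixedPoint d ω) (hd : 3 ≤ d) (hf : InvWeight d f) {u : List ℕ}
    (hu : u ≠ factorAt ω 0 u.length) {a : ℕ} (ha : 0 < f (a :: u)) : f (a :: u) = f u := by
  rw [hf.left u, Finset.sum_eq_single a]
  · intro b _ hb
    refine (hf.eq_zero_or_pos _).resolve_right fun h => hu ?_
    exact hf.eq_prefix_of_leftSpecial hω hd hb h ha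
  · intro h
    exact absurd (Finset.mem_Icc.2 (((hf.lang_of_pos ha).admissible hd).1 a (by simp))) h

variable (hω : IsSigmaFixedPoint d ω) (hd : 3 ≤ d) (hr0 : 0 < r) (hf : InvWeight d f)
  (hc : 0 < f [1]) (he : PrefixExponents d ω f r e)

include hω hd hr0 hf hc he

lemma pos_of_lang {u : List ℕ} (hu : Lang d u) : 0 < f u := by
  obtain ⟨p, hp⟩ := hω.eq_factorAt_of_lang hu
  have hinf : u <:+: factorAt ω 0 (p + u.length + 1) := by
    rw [Nat.add_assoc, factorAt_add, zero_add]
    refine List.IsInfix.trans ?_ (List.suffix_append _ _).isInfix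
    rw [factorAt_succ, ← hp]
    exact (List.prefix_append _ _).isInfix
  refine lt_of_lt_of_le ?_ (hf.le_of_isInfix hd hinf)
  rw [he.value]
  positivity

omit hω hd hf in
lemma cons_prefix_pos {a : ℕ} (ha : 1 ≤ a) (had : a ≤ d) (n : ℕ) :
    0 < f (a :: factorAt ω 0 (n + 1)) := by
  obtain ⟨i, -, hi⟩ := (he.image n).subset ⟨a, ⟨ha, had⟩, rfl⟩
  rw [← show f [1] * r ^ i = f (a :: factorAt ω 0 (n + 1)) from hi]
  positivity

lemma weightValues_succ (n : ℕ) : weightValues d f (n + 1 + 1) =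
    {x | ∃ u, Lang d u ∧ u.length = n + 1 ∧ u ≠ factorAt ω 0 (n + 1) ∧ f u = x} ∪
      (fun i => f [1] * r ^ i) '' Set.Icc (e n + (d - 1)) (e n + (2 * d - 2)) := by
  rw [← he.image n]
  ext x
  constructor
  · rintro ⟨_ | ⟨a, u⟩, hu, hl, rfl⟩
    · simp at hl
    · obtain rfl | hne := eq_or_ne u (factorAt ω 0 (n + 1))
      · exact .inr ⟨a, (hu.admissible hd).1 a (by simp), rfl⟩
      · have hlen : u.length = n + 1 := by simpa using hl
        refine .inl ⟨u, hu.of_isInfix (List.suffix_cons _ _).isInfix, hlen, hne, ?_⟩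
        exact (hf.cons_eq_of_ne hω hd (by rwa [hlen])
          (pos_of_lang hω hd hr0 hf hc he hu)).symm
  · rintro (⟨u, hu, hl, hne, rfl⟩ | ⟨a, ⟨ha, had⟩, rfl⟩)
    · obtain ⟨a, -, -, ha⟩ := hf.exists_cons_pos (pos_of_lang hω hd hr0 hf hc he hu)
      exact ⟨a :: u, hf.lang_of_pos ha, by simp [hl],
        hf.cons_eq_of_ne hω hd (by rwa [hl]) ha⟩
    · exact ⟨_, hf.lang_of_pos (cons_prefix_pos hr0 hc he ha had n), by simp, rfl⟩

omit hr0 hc he in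
lemma prefix_eq_of_not_rightSpecial {n : ℕ} (h : ¬ RightSpecial d (factorAt ω 0 (n + 1))) :
    f (factorAt ω 0 (n + 1 + 1)) = f (factorAt ω 0 (n + 1)) := by
  have hP := factorAt_succ ω 0 (n + 1)
  rw [zero_add] at hP
  have hx := hω.one_le hd (n + 1)
  rw [hP, hf.right (factorAt ω 0 (n + 1)), Finset.sum_eq_single (ω (n + 1))]
  · intro b hb hne
    rw [Finset.mem_Icc] at hb
    refine (hf.eq_zero_or_pos _).resolve_right fun hpos => h ?_
    exact ⟨b, ω (n + 1), hne, hb.1, hb.2, hx.1, hx.2, hf.lang_of_pos hpos,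
      hP ▸ hω.lang_factorAt 0 (n + 1 + 1)⟩
  · intro h; simp at h; omega

lemma weightValues_of_not_rightSpecial {n : ℕ}
    (h : ¬ RightSpecial d (factorAt ω 0 (n + 1))) :
    {x | ∃ u, Lang d u ∧ u.length = n + 1 ∧ u ≠ factorAt ω 0 (n + 1) ∧ f u = x} =
      weightValues d f (n + 1) := by
  refine Set.Subset.antisymm (fun x ⟨u, hu, hl, _, hx⟩ => ⟨u, hu, hl, hx⟩) ?_
  rintro _ ⟨u, hu, hl, rfl⟩
  obtain rfl | hne := eq_or_ne u (factorAt ω 0 (n + 1))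
  · have hne := hω.tail_ne (n := n + 1) (by omega)
    refine ⟨factorAt ω 1 (n + 1), hω.lang_factorAt _ _, by simp, hne, ?_⟩
    have hcons : factorAt ω 0 (n + 1 + 1) = ω 0 :: factorAt ω 1 (n + 1) := factorAt_succ' _ _ _
    rw [← prefix_eq_of_not_rightSpecial hω hd hf h, hcons]
    refine (hf.cons_eq_of_ne hω hd (by simpa using hne) ?_).symm
    rw [← hcons]
    exact pos_of_lang hω hd hr0 hf hc he (hω.lang_factorAt _ _)
  · exact ⟨u, hu, hl, hne, rfl⟩

lemma append_lt_of_rightSpecial {u : List ℕ} (h : RightSpecial d u) (x : ℕ) :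
    f (u ++ [x]) < f u := by
  obtain ⟨y, hy1, hyd, hyx, hy⟩ : ∃ y, 1 ≤ y ∧ y ≤ d ∧ y ≠ x ∧ Lang d (u ++ [y]) := by
    obtain ⟨a, b, hab, ha1, had, hb1, hbd, ha, hb⟩ := h
    by_cases hax : a = x
    · exact ⟨b, hb1, hbd, by omega, hb⟩
    · exact ⟨a, ha1, had, hax, ha⟩
  have hy := pos_of_lang hω hd hr0 hf hc he hy
  have hu := hf.append_singleton_le hd u y
  rcases hf.eq_zero_or_pos (u ++ [x]) with h0 | h0
  · linarith
  · have hx := ((hf.lang_of_pos h0).admissible hd).1 x (by simp)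
    have := Finset.add_le_sum (f := fun a => f (u ++ [a])) (s := Finset.Icc 1 d)
      (fun _ _ => hf.nonneg _) (Finset.mem_Icc.2 hx) (Finset.mem_Icc.2 ⟨hy1, hyd⟩) hyx.symm
    rw [← hf.right] at this
    linarith

lemma lt_prefix_of_rightSpecial {n : ℕ} (h : RightSpecial d (factorAt ω 0 (n + 1))) (p : ℕ)
    {m : ℕ} (hm : n + 1 ≤ m)
    (hpm : n + 1 < m ∨ factorAt ω p (n + 1) ≠ factorAt ω 0 (n + 1)) :
    f (factorAt ω p m) < f (factorAt ω 0 (n + 1)) := by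
  induction p generalizing m with
  | zero =>
    refine (hf.le_of_isPrefix hd (factorAt_isPrefix ω 0 (show n + 1 + 1 ≤ m by grind))).trans_lt ?_
    rw [factorAt_succ]
    exact append_lt_of_rightSpecial hω hd hr0 hf hc he h _
  | succ p ih =>
    by_cases hw : factorAt ω (p + 1) (n + 1) = factorAt ω 0 (n + 1)
    · refine (hf.le_of_isPrefix hd
        (factorAt_isPrefix ω (p + 1) (show n + 1 + 1 ≤ m by grind))).trans_lt ?_
      rw [factorAt_succ, hw]
      exact append_lt_of_rightSpecial hω hd hr0 hf hc he h _
    · have hne : factorAt ω (p + 1) m ≠ factorAt ω 0 m := fun heq => hw <| by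
        have := eq_factorAt_of_isPrefix (heq ▸ factorAt_isPrefix ω (p + 1) hm)
        rwa [length_factorAt] at this
      have := ih (m := m + 1) (by omega) (.inl (by omega))
      rw [factorAt_succ'] at this
      rwa [hf.cons_eq_of_ne hω hd (by simpa using hne)] at this
      rw [← factorAt_succ']
      exact pos_of_lang hω hd hr0 hf hc he (hω.lang_factorAt _ _)

lemma weightValues_of_rightSpecial {n : ℕ} (h : RightSpecial d (factorAt ω 0 (n + 1))) :
    {x | ∃ u, Lang d u ∧ u.length = n + 1 ∧ u ≠ factorAt ω 0 (n + 1) ∧ f u = x} =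
      weightValues d f (n + 1) \ {f [1] * r ^ e n} := by
  rw [← he.value]
  ext x
  constructor
  · rintro ⟨u, hu, hl, hne, rfl⟩
    refine ⟨⟨u, hu, hl, rfl⟩, fun heq => ?_⟩
    obtain ⟨p, hp⟩ := hω.eq_factorAt_of_lang hu
    rw [hl] at hp
    subst hp
    exact (lt_prefix_of_rightSpecial hω hd hr0 hf hc he h p le_rfl (.inr hne)).ne heq
  · rintro ⟨⟨u, hu, hl, rfl⟩, hne⟩
    exact ⟨u, hu, hl, fun h => hne (by rw [h]; rfl), rfl⟩

end InvWeight

end Values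

section Counting

variable {d : ℕ} {ω : ℕ → ℕ} {f : List ℕ → ℝ} {r : ℝ} {e : ℕ → ℕ}

lemma sq_le_one_sub_pow (hd : 3 ≤ d) (hr0 : 0 < r) (hr1 : r < 1) (hr : r + r ^ d = 1) :
    r ^ 2 ≤ 1 - r ^ (d - 1) := by
  have h1 : r ^ d ≤ r ^ 2 := pow_le_pow_of_le_one hr0.le hr1.le (by omega)
  have h2 : r ^ d = r * r ^ (d - 1) := by rw [← pow_succ', Nat.sub_add_cancel (by omega)]
  have h3 : 0 ≤ (1 - r) * (r ^ 2 + r - 1) := mul_nonneg (by linarith) (by linarith)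
  refine le_of_mul_le_mul_left ?_ hr0
  linarith

namespace InvWeight

lemma injective_mul_pow (hr0 : 0 < r) (hr1 : r < 1) {c : ℝ} (hc : 0 < c) :
    Function.Injective fun i : ℕ => c * r ^ i := fun _ _ h =>
  pow_right_injective₀ hr0 hr1.ne (mul_left_cancel₀ hc.ne' h)

variable (hω : IsSigmaFixedPoint d ω) (hd : 3 ≤ d) (hr0 : 0 < r) (hr1 : r < 1)
  (hf : InvWeight d f) (hc : 0 < f [1]) (he : PrefixExponents d ω f r e)

include hω hd hr0 hr1 hf hc he

lemma exponent_of_not_rightSpecial {n : ℕ} (h : ¬ RightSpecial d (factorAt ω 0 (n + 1))) :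
    e (n + 1) = e n := by
  have := prefix_eq_of_not_rightSpecial hω hd hf h
  rw [he.value, he.value] at this
  exact injective_mul_pow hr0 hr1 hc this

lemma exponent_of_rightSpecial (hr : r + r ^ d = 1) {n : ℕ}
    (h : RightSpecial d (factorAt ω 0 (n + 1))) : e (n + 1) = e n + 1 := by
  set P := factorAt ω 0 (n + 1) with hP
  have hPx : factorAt ω 0 (n + 1 + 1) = P ++ [ω (n + 1)] := by rw [factorAt_succ, zero_add]
  have hPn : P = factorAt ω 0 n ++ [ω n] := by rw [hP, factorAt_succ, zero_add]
  have hlt := append_lt_of_rightSpecial hω hd hr0 hf hc he h (ω (n + 1))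
  have hx := hω.succ_eq hd n
  have ht := hω.one_le hd n
  have htd : ω n < d := by
    refine ht.2.lt_of_ne fun htd => hlt.ne ?_
    have hx1 : ω (n + 1) = 1 := by
      have := (hω.one_le hd (n + 1)).2
      omega
    rw [hx1, hPn, htd, hf.right_last hd]
    simp
  obtain ⟨y, hyx, hy⟩ : ∃ y, y ≠ ω (n + 1) ∧
      ∀ z, f (z ++ P) = f (z ++ P ++ [ω (n + 1)]) + f (z ++ P ++ [y]) := by
    have hz : ∀ z, f (z ++ P) = f (z ++ P ++ [1]) + f (z ++ P ++ [ω n + 1]) := fun z => by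
      rw [hPn, ← List.append_assoc, hf.right_lt hd _ ht.1 htd]
      simp
    rcases hx with hx | hx <;> rw [hx]
    · exact ⟨ω n + 1, by omega, hz⟩
    · exact ⟨1, by omega, fun z => by rw [hz, add_comm]⟩
  have h0 := hy []
  simp only [List.nil_append] at h0
  obtain ⟨b, hb1, hbd, hb⟩ := hf.exists_cons_pos (u := P ++ [y]) (by linarith)
  have hbeq : f (b :: (P ++ [y])) = f (P ++ [y]) := by
    refine hf.cons_eq_of_ne hω hd (fun heq => hyx ?_) hb
    rw [List.length_append, List.length_singleton, hP, length_factorAt, hPx] at heq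
    simpa using (List.append_inj' heq rfl).2
  have hbP := hy [b]
  simp only [List.cons_append, List.nil_append] at hbP
  have hbx : 0 < f (b :: (P ++ [ω (n + 1)])) := by
    rw [← hPx]
    exact cons_prefix_pos hr0 hc he hb1 hbd (n + 1)
  obtain ⟨i, ⟨hi, -⟩, hbi⟩ := (he.image n).subset ⟨b, ⟨hb1, hbd⟩, rfl⟩
  replace hbi : f [1] * r ^ i = f (b :: P) := hbi
  have hle : f (b :: P) ≤ f [1] * (r ^ e n * r ^ (d - 1)) := by
    rw [← hbi, ← pow_add]
    exact mul_le_mul_of_nonneg_left (pow_le_pow_of_le_one hr0.le hr1.le hi) hc.le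
  have hv1 : f P = f [1] * r ^ e n := he.value n
  have hv2 : f (P ++ [ω (n + 1)]) = f [1] * r ^ e (n + 1) := hPx ▸ he.value (n + 1)
  have hsq := mul_le_mul_of_nonneg_left (sq_le_one_sub_pow hd hr0 hr1 hr)
    (show 0 ≤ f [1] * r ^ e n by positivity)
  have hlow : e n < e (n + 1) := by
    rw [hv1, hv2] at hlt
    exact (pow_lt_pow_iff_right_of_lt_one₀ hr0 hr1).1 (lt_of_mul_lt_mul_left hlt hc.le)
  have hupp : e (n + 1) < e n + 2 := by
    refine (pow_lt_pow_iff_right_of_lt_one₀ hr0 hr1).1 (lt_of_mul_lt_mul_left ?_ hc.le)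
    rw [pow_add, ← hv2]
    linarith
  omega

omit hω hr1 he in
lemma weightValues_one (hr : r + r ^ d = 1) :
    weightValues d f 1 = (fun i => f [1] * r ^ i) '' Set.Icc 0 (d - 1) := by
  ext x
  constructor
  · rintro ⟨u, hu, hl, rfl⟩
    obtain ⟨a, rfl⟩ := List.length_eq_one_iff.1 hl
    obtain ⟨ha1, had⟩ := (hu.admissible hd).1 a (by simp)
    obtain ⟨a, rfl⟩ := Nat.exists_eq_add_of_le' ha1
    exact ⟨a, ⟨Nat.zero_le _, by omega⟩, (hf.letter hd hr0 hr had).symm⟩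
  · rintro ⟨i, ⟨-, hi⟩, rfl⟩
    have h := hf.letter hd hr0 hr (a := i) (by omega)
    exact ⟨[i + 1], hf.lang_of_pos (by rw [h]; positivity), rfl, h⟩

omit hd hf in
lemma exponent_zero : e 0 = 0 := by
  have h := he.value 0
  rw [factorAt_succ, factorAt_zero, List.nil_append, hω.zero_eq] at h
  exact (injective_mul_pow hr0 hr1 hc (show f [1] * r ^ 0 = f [1] * r ^ e 0 by
    rw [← h]; simp)).symm

lemma weightValues_succ_eq_of_bounds (hr : r + r ^ d = 1) {n H : ℕ}
    (hV : weightValues d f (n + 1) = (fun i => f [1] * r ^ i) '' Set.Icc (e n) H)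
    (h1 : e n + (d - 1) ≤ H + 1) (h2 : H ≤ e n + (2 * d - 2)) :
    weightValues d f (n + 1 + 1) =
      (fun i => f [1] * r ^ i) '' Set.Icc (e (n + 1)) (e n + (2 * d - 2)) := by
  rw [weightValues_succ hω hd hr0 hf hc he]
  by_cases h : RightSpecial d (factorAt ω 0 (n + 1))
  · rw [weightValues_of_rightSpecial hω hd hr0 hf hc he h, hV,
      exponent_of_rightSpecial hω hd hr0 hr1 hf hc he hr h,
      ← Set.image_singleton (f := fun i => f [1] * r ^ i),
      ← Set.image_sdiff (injective_mul_pow hr0 hr1 hc), ← Set.image_union]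
    congr 1
    ext i
    simp only [Set.mem_union, Set.mem_sdiff, Set.mem_Icc, Set.mem_singleton_iff]
    omega
  · rw [weightValues_of_not_rightSpecial hω hd hr0 hf hc he h, hV,
      exponent_of_not_rightSpecial hω hd hr0 hr1 hf hc he h, ← Set.image_union]
    congr 1
    ext i
    simp only [Set.mem_union, Set.mem_Icc]
    omega

lemma exists_weightValues_eq (hr : r + r ^ d = 1) (n : ℕ) : ∃ H,
    weightValues d f (n + 1) = (fun i => f [1] * r ^ i) '' Set.Icc (e n) H ∧
      e n + (d - 1) ≤ H + 1 ∧ H ≤ e n + (2 * d - 2) := by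
  induction n with
  | zero =>
    rw [exponent_zero hω hr0 hr1 hc he]
    exact ⟨d - 1, weightValues_one hd hr0 hf hc hr, by omega, by omega⟩
  | succ n ih =>
    obtain ⟨H, hV, h1, h2⟩ := ih
    refine ⟨_, weightValues_succ_eq_of_bounds hω hd hr0 hr1 hf hc he hr hV h1 h2, ?_⟩
    by_cases h : RightSpecial d (factorAt ω 0 (n + 1))
    · rw [exponent_of_rightSpecial hω hd hr0 hr1 hf hc he hr h]; omega
    · rw [exponent_of_not_rightSpecial hω hd hr0 hr1 hf hc he h]; omega

lemma ncard_weightValues (hr : r + r ^ d = 1) (n : ℕ) :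
    (weightValues d f (n + 1 + 1)).ncard = e n + (2 * d - 2) + 1 - e (n + 1) := by
  obtain ⟨H, hV, h1, h2⟩ := exists_weightValues_eq hω hd hr0 hr1 hf hc he hr n
  rw [weightValues_succ_eq_of_bounds hω hd hr0 hr1 hf hc he hr hV h1 h2,
    Set.ncard_image_of_injective _ (injective_mul_pow hr0 hr1 hc), ← Finset.coe_Icc,
    Set.ncard_coe_finset, Nat.card_Icc]

omit hr1 in
lemma exists_bispecial_iff (n : ℕ) :
    (∃ u, Lang d u ∧ Bispecial d u ∧ u.length = n + 1) ↔
      RightSpecial d (factorAt ω 0 (n + 1)) := by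
  have hpos : ∀ u, Lang d u → 0 < f u := fun u hu => pos_of_lang hω hd hr0 hf hc he hu
  constructor
  · rintro ⟨u, -, ⟨⟨a, b, hab, -, -, -, -, ha, hb⟩, hR⟩, hl⟩
    have := hf.eq_prefix_of_leftSpecial hω hd hab (hpos _ ha) (hpos _ hb)
    rw [hl] at this
    rwa [← this]
  · intro h
    have hL : ∀ a, 1 ≤ a → a ≤ d → Lang d (a :: factorAt ω 0 (n + 1)) := fun a ha had =>
      hf.lang_of_pos (cons_prefix_pos hr0 hc he ha had n)
    exact ⟨_, hω.lang_factorAt _ _, ⟨⟨1, 2, by omega, by omega, by omega, by omega, by omega,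
      hL 1 (by omega) (by omega), hL 2 (by omega) (by omega)⟩, h⟩, by simp⟩

end InvWeight

/-- The number of values of a nonzero invariant weight on the words of given length. -/
theorem InvWeight.ncard_weightValues_eq (hω : IsSigmaFixedPoint d ω) (hd : 3 ≤ d)
    (hf : InvWeight d f) (h1 : f [] = 1) :
    (weightValues d f 1).ncard = d ∧ ∀ n : ℕ, 2 ≤ n →
      ((∃ u : List ℕ, Lang d u ∧ Bispecial d u ∧ u.length = n - 1) →
        (weightValues d f n).ncard = 2 * d - 2) ∧
      (¬ (∃ u : List ℕ, Lang d u ∧ Bispecial d u ∧ u.length = n - 1) →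
        (weightValues d f n).ncard = 2 * d - 1) := by
  obtain ⟨r, hr0, hr1, hr⟩ := exists_root_add_pow hd
  have hc : 0 < f [1] := by
    refine (hf.eq_zero_or_pos _).resolve_left fun h0 => one_ne_zero (α := ℝ) ?_
    rw [← h1, hf.right]
    refine Finset.sum_eq_zero fun a ha => ?_
    rw [Finset.mem_Icc] at ha
    obtain ⟨a, rfl⟩ := Nat.exists_eq_add_of_le' ha.1
    rw [List.nil_append, hf.letter hd hr0 hr (by omega), h0, zero_mul]
  choose e he' using hω.exists_exponent hd hr0 hr
  have he : PrefixExponents d ω f r e := ⟨fun n => (he' n f hf).1, fun n => (he' n f hf).2⟩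
  refine ⟨?_, fun n hn => ?_⟩
  · rw [weightValues_one hd hr0 hf hc hr,
      Set.ncard_image_of_injective _ (injective_mul_pow hr0 hr1 hc), ← Finset.coe_Icc,
      Set.ncard_coe_finset, Nat.card_Icc]
    omega
  · obtain ⟨n, rfl⟩ := Nat.exists_eq_add_of_le' hn
    rw [show n + 2 - 1 = n + 1 by omega, exists_bispecial_iff hω hd hr0 hf hc he,
      ncard_weightValues hω hd hr0 hr1 hf hc he hr]
    refine ⟨fun h => ?_, fun h => ?_⟩
    · rw [exponent_of_rightSpecial hω hd hr0 hr1 hf hc he hr h]; omega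
    · rw [exponent_of_not_rightSpecial hω hd hr0 hr1 hf hc he h]; omega

end Counting

section Cylinders

open MeasureTheory

variable {d : ℕ} {ω : ℕ → ℕ}

lemma continuous_shiftMap : Continuous shiftMap :=
  continuous_pi fun i => continuous_apply (i + 1)

lemma iterate_shiftMap (n : ℕ) : shiftMap^[n] ω = fun i => ω (n + i) := by
  induction n with
  | zero => simp
  | succ n ih =>
    rw [Function.iterate_succ_apply', ih]
    ext i
    simp only [shiftMap]
    congr 1
    omega

lemma shiftMap_mem_omegaPlus {V : ℕ → ℕ} (hV : V ∈ OmegaPlus ω) : shiftMap V ∈ OmegaPlus ω := by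
  refine map_mem_closure continuous_shiftMap hV ?_
  rintro _ ⟨n, rfl⟩
  exact ⟨n + 1, (Function.iterate_succ_apply' _ _ _).symm⟩

lemma isOpen_prefixOfInf (u : List ℕ) : IsOpen {V | PrefixOfInf u V} := by
  have h : {V | PrefixOfInf u V} = ⋂ i : Fin u.length, (fun V : ℕ → ℕ => V i) ⁻¹' {u.get i} := by
    ext V
    simp only [PrefixOfInf, Set.mem_ofPred_eq, Set.mem_iInter, Set.mem_preimage,
      Set.mem_singleton_iff]
    exact ⟨fun h i => (h i i.2).symm, fun h i hi => (h ⟨i, hi⟩).symm⟩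
  rw [h]
  exact isOpen_iInter_of_finite fun i => (isOpen_discrete _).preimage (continuous_apply _)

lemma measurableSet_cyl (u : List ℕ) : MeasurableSet (Cyl ω u) :=
  isClosed_closure.measurableSet.inter (isOpen_prefixOfInf u).measurableSet

lemma cyl_nil : Cyl ω [] = OmegaPlus ω := by
  ext V
  simp [Cyl, PrefixOfInf]

lemma IsSigmaFixedPoint.lang_of_mem_cyl (hω : IsSigmaFixedPoint d ω) {u : List ℕ} {V : ℕ → ℕ}
    (hV : V ∈ Cyl ω u) : Lang d u := by
  obtain ⟨_, hW, n, rfl⟩ := mem_closure_iff.1 hV.1 _ (isOpen_prefixOfInf u) hV.2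
  rw [Set.mem_ofPred_eq, prefixOfInf_iff, iterate_shiftMap] at hW
  rw [hW]
  simpa [factorAt] using hω.lang_factorAt n u.length

lemma mem_cyl_append_singleton {u : List ℕ} {a : ℕ} {V : ℕ → ℕ} :
    V ∈ Cyl ω (u ++ [a]) ↔ V ∈ Cyl ω u ∧ V u.length = a := by
  simp only [Cyl, Set.mem_ofPred_eq, prefixOfInf_iff, and_assoc]
  refine and_congr_right fun _ => ?_
  rw [List.length_append, List.length_singleton, factorAt_succ, zero_add]
  refine ⟨fun h => ?_, fun ⟨h1, h2⟩ => by rw [← h1, h2]⟩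
  obtain ⟨h1, h2⟩ := List.append_inj' h rfl
  exact ⟨h1, by simpa using h2.symm⟩

lemma mem_cyl_cons {u : List ℕ} {a : ℕ} {V : ℕ → ℕ} :
    V ∈ Cyl ω (a :: u) ↔ V ∈ shiftMap ⁻¹' Cyl ω u ∩ OmegaPlus ω ∧ V 0 = a := by
  have h : factorAt (shiftMap V) 0 u.length = factorAt V 1 u.length := by
    simp [factorAt, shiftMap, add_comm]
  simp only [Cyl, Set.mem_ofPred_eq, prefixOfInf_iff, Set.mem_inter_iff, Set.mem_preimage, h,
    List.length_cons, factorAt_succ', List.cons.injEq, zero_add]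
  refine ⟨fun ⟨h1, h2, h3⟩ => ⟨⟨⟨shiftMap_mem_omegaPlus h1, h3⟩, h1⟩, h2.symm⟩,
    fun ⟨⟨⟨_, h3⟩, h1⟩, h2⟩ => ⟨h1, h2.symm, h3⟩⟩

/-- An invariant measure of cylinders is an invariant weight on words. -/
lemma invWeight_measure_cyl (hω : IsSigmaFixedPoint d ω) (hd : 3 ≤ d) {μ : Measure (ℕ → ℕ)}
    [IsFiniteMeasure μ]
    (hinv : ∀ B : Set (ℕ → ℕ), MeasurableSet B → B ⊆ OmegaPlus ω →
      μ (shiftMap ⁻¹' B ∩ OmegaPlus ω) = μ B) :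
    InvWeight d fun u => (μ (Cyl ω u)).toReal where
  nonneg _ := ENNReal.toReal_nonneg
  supp u hu := by
    rw [Set.eq_empty_of_forall_notMem fun V hV => hu (hω.lang_of_mem_cyl hV), measure_empty,
      ENNReal.toReal_zero]
  right u := by
    have h : Cyl ω u = ⋃ a ∈ Finset.Icc 1 d, Cyl ω (u ++ [a]) := by
      ext V
      simp only [Set.mem_iUnion, mem_cyl_append_singleton, exists_prop]
      refine ⟨fun hV => ⟨V u.length, Finset.mem_Icc.2 ?_, hV, rfl⟩, fun ⟨_, _, hV, _⟩ => hV⟩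
      have hV' : V ∈ Cyl ω (u ++ [V u.length]) := mem_cyl_append_singleton.2 ⟨hV, rfl⟩
      exact ((hω.lang_of_mem_cyl hV').admissible hd).1 _ (by simp)
    conv_lhs => rw [h]
    refine measureReal_biUnion_finset (fun a _ b _ hab => ?_) fun a _ => measurableSet_cyl _
    exact Set.disjoint_left.2 fun V ha hb => hab <|
      (mem_cyl_append_singleton.1 ha).2.symm.trans (mem_cyl_append_singleton.1 hb).2
  left u := by
    have h : shiftMap ⁻¹' Cyl ω u ∩ OmegaPlus ω = ⋃ a ∈ Finset.Icc 1 d, Cyl ω (a :: u) := by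
      ext V
      simp only [Set.mem_iUnion, mem_cyl_cons, exists_prop]
      refine ⟨fun hV => ⟨V 0, Finset.mem_Icc.2 ?_, hV, rfl⟩, fun ⟨_, _, hV, _⟩ => hV⟩
      have hV' : V ∈ Cyl ω (V 0 :: u) := mem_cyl_cons.2 ⟨hV, rfl⟩
      exact ((hω.lang_of_mem_cyl hV').admissible hd).1 _ (by simp)
    rw [← hinv _ (measurableSet_cyl u) fun V hV => hV.1, h]
    refine measureReal_biUnion_finset (fun a _ b _ hab => ?_) fun a _ => measurableSet_cyl _
    exact Set.disjoint_left.2 fun V ha hb => hab <|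
      (mem_cyl_cons.1 ha).2.symm.trans (mem_cyl_cons.1 hb).2

end Cylinders

open MeasureTheory in
/-- For a shift-invariant Borel probability measure μ on Ω⁺: #E_1 = d, and for n ≥ 2,
#E_n = 2d−2 if L(Ω) contains a bispecial word of length n−1, and #E_n = 2d−1
otherwise. -/
theorem stmt_17 (d : ℕ) (hd : 3 ≤ d) (ω : ℕ → ℕ) (hω : IsSigmaFixedPoint d ω)
    (μ : Measure (ℕ → ℕ)) [IsProbabilityMeasure μ]
    (hμΩ : μ (OmegaPlus ω) = 1)
    (hinv : ∀ B : Set (ℕ → ℕ), MeasurableSet B → B ⊆ OmegaPlus ω →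
      μ (shiftMap ⁻¹' B ∩ OmegaPlus ω) = μ B) :
    Set.ncard (cylValues ω μ d 1) = d ∧
    ∀ n : ℕ, 2 ≤ n →
      ((∃ u : List ℕ, Lang d u ∧ Bispecial d u ∧ u.length = n - 1) →
        Set.ncard (cylValues ω μ d n) = 2 * d - 2) ∧
      (¬ (∃ u : List ℕ, Lang d u ∧ Bispecial d u ∧ u.length = n - 1) →
        Set.ncard (cylValues ω μ d n) = 2 * d - 1) := by
  have hf := invWeight_measure_cyl hω hd hinv
  refine hf.ncard_weightValues_eq hω hd ?_
  rw [cyl_nil, hμΩ, ENNReal.toReal_one]
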